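/- Let n ≥ 2 and fix signs ε_1,…,ε_n ∈ {1,−1}. There is a constant C > 0 such that for every F ∈ 𝒮(ℝ×ℝⁿ), every j ∈ ℤ, and every unit vector e ∈ S^{n−1}, 2^{j/2} ‖P_j Q^{e_±}_{j,20} ∫_0^t W_±(t−s)F(s)ds‖_{L^{∞,2}_e} ≤ C 2^{−j/2} sup_{e'∈S^{n−1}} ‖P_j F‖_{L^{1,2}_{e'}}. -/

import Mathlib

open MeasureTheory Complex Filter
open scoped FourierTransform RealInnerProductSpace ENNReal NNReal Topology

noncomputable section

namespace DNLS

/-- Euclidean space ℝⁿ. -/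
abbrev Eucl (n : ℕ) := EuclideanSpace ℝ (Fin n)

/-- The quadratic symbol `|ξ|²_± = Σ εᵢ ξᵢ²`. -/
def quadSym {n : ℕ} (ε : Fin n → ℝ) (ξ : Eucl n) : ℝ := ∑ i, ε i * (ξ i) ^ 2

/-- The signed vector `e_± = (ε₁e₁, …, εₙeₙ)`. -/
def epm {n : ℕ} (ε : Fin n → ℝ) (e : Eucl n) : Eucl n := WithLp.toLp 2 (fun i => ε i * e i)

/-- Fourier multiplier operator with symbol `m`. -/
def mulOp {n : ℕ} (m : Eucl n → ℂ) (f : Eucl n → ℂ) : Eucl n → ℂ :=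
  𝓕⁻ (fun ξ => m ξ * 𝓕 f ξ)

/-- The propagator `W_±(t)`, with `(W_±(t)φ)^(ξ) = e^{-it|ξ|²_±} φ̂(ξ)`. -/
def prop {n : ℕ} (ε : Fin n → ℝ) (t : ℝ) (φ : Eucl n → ℂ) : Eucl n → ℂ :=
  mulOp (fun ξ => Complex.exp (-Complex.I * t * quadSym ε ξ)) φ

/-- Fourier multiplier operator acting in the space variable of a space-time function. -/
def mulOpT {n : ℕ} (m : Eucl n → ℂ) (u : ℝ × Eucl n → ℂ) : ℝ × Eucl n → ℂ :=
  fun p => mulOp m (fun y => u (p.1, y)) p.2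

/-- Hypotheses on the bump function χ : even, smooth, compactly supported in (-2,2),
equal to one on [-1,1]. -/
structure IsBump (χ : ℝ → ℝ) : Prop where
  smooth : ∀ k : ℕ, ContDiff ℝ k χ
  even : ∀ s, χ (-s) = χ s
  supp : ∀ s, 2 ≤ |s| → χ s = 0
  one : ∀ s, |s| ≤ 1 → χ s = 1

/-- `ψ(s) = χ(|s|) - χ(2|s|)`. -/
def psiR (χ : ℝ → ℝ) (s : ℝ) : ℝ := χ |s| - χ (2 * |s|)

/-- `ψ_{≥k}(s) = Σ_{m ≥ k} ψ(2^{-m} s)`. -/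
def psiGe (χ : ℝ → ℝ) (k : ℤ) (s : ℝ) : ℝ :=
  ∑' m : ℤ, if k ≤ m then psiR χ ((2 : ℝ) ^ (-m) * s) else 0

/-- Littlewood–Paley projection `P_j`. -/
def proj {n : ℕ} (χ : ℝ → ℝ) (j : ℤ) (f : Eucl n → ℂ) : Eucl n → ℂ :=
  mulOp (fun ξ => (psiR χ ((2 : ℝ) ^ (-j) * ‖ξ‖) : ℂ)) f

/-- Low-frequency projection `P_{≤0} = I - Σ_{j≥1} P_j`. -/
def lowProj {n : ℕ} (χ : ℝ → ℝ) (f : Eucl n → ℂ) : Eucl n → ℂ :=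
  mulOp (fun ξ => ((1 - psiGe χ 1 ‖ξ‖ : ℝ) : ℂ)) f

/-- Directional frequency cutoff `Q^{e}_{j,l}` with symbol `ψ_{≥ j-l}(ξ·e)`. -/
def qproj {n : ℕ} (χ : ℝ → ℝ) (e : Eucl n) (j l : ℤ) (f : Eucl n → ℂ) : Eucl n → ℂ :=
  mulOp (fun ξ => ((psiGe χ (j - l) (inner ℝ ξ e : ℝ) : ℝ) : ℂ)) f

/-- `P_j` acting in the space variable of a space-time function. -/
def projT {n : ℕ} (χ : ℝ → ℝ) (j : ℤ) (u : ℝ × Eucl n → ℂ) : ℝ × Eucl n → ℂ :=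
  fun p => proj χ j (fun y => u (p.1, y)) p.2

/-- `P_{≤0}` acting in the space variable of a space-time function. -/
def lowProjT {n : ℕ} (χ : ℝ → ℝ) (u : ℝ × Eucl n → ℂ) : ℝ × Eucl n → ℂ :=
  fun p => lowProj χ (fun y => u (p.1, y)) p.2

/-- `Q^{e}_{j,l}` acting in the space variable of a space-time function. -/
def qprojT {n : ℕ} (χ : ℝ → ℝ) (e : Eucl n) (j l : ℤ) (u : ℝ × Eucl n → ℂ) :
    ℝ × Eucl n → ℂ :=
  fun p => qproj χ e j l (fun y => u (p.1, y)) p.2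

/-- The hyperplane `P_e = {ξ : ξ·e = 0}`. -/
def hyperplane {n : ℕ} (e : Eucl n) : Submodule ℝ (Eucl n) := (ℝ ∙ e)ᗮ

/-- Inner part of the anisotropic norm: the `L^q` norm over `P_e × ℝ` of
`(t,v) ↦ u(t, re + v)`. -/
def innerQ {n : ℕ} (q : ℝ≥0∞) (e : Eucl n) (u : ℝ × Eucl n → ℂ) (r : ℝ) : ℝ≥0∞ :=
  eLpNorm (fun tv : ℝ × (hyperplane e) => u (tv.1, r • e + (tv.2 : Eucl n))) q volume

/-- The anisotropic norm `‖u‖_{L^{p,q}_e}`. -/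
def aniNorm {n : ℕ} (p q : ℝ≥0∞) (e : Eucl n) (u : ℝ × Eucl n → ℂ) : ℝ≥0∞ :=
  if p = ∞ then essSup (innerQ q e u) volume
  else (∫⁻ r : ℝ, innerQ q e u r ^ p.toReal) ^ (1 / p.toReal)

/-- The mixed space-time norm `‖u‖_{L^q_t L^r_x}`. -/
def mixNorm {n : ℕ} (q r : ℝ≥0∞) (u : ℝ × Eucl n → ℂ) : ℝ≥0∞ :=
  if q = ∞ then essSup (fun t => eLpNorm (fun x => u (t, x)) r volume) volume
  else (∫⁻ t : ℝ, eLpNorm (fun x => u (t, x)) r volume ^ q.toReal) ^ (1 / q.toReal)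

/-- `2^a` as an extended nonnegative real. -/
def tp (a : ℝ) : ℝ≥0∞ := ENNReal.ofReal ((2 : ℝ) ^ a)

/-- Homogeneous Besov norm `‖φ‖_{Ḃ^s_{2,1}}`. -/
def homBesov {n : ℕ} (χ : ℝ → ℝ) (s : ℝ) (φ : Eucl n → ℂ) : ℝ≥0∞ :=
  ∑' j : ℤ, tp (s * j) * eLpNorm (proj χ j φ) 2 volume

/-- Inhomogeneous Besov norm `‖φ‖_{B^s_{2,1}}`. -/
def besov {n : ℕ} (χ : ℝ → ℝ) (s : ℝ) (φ : Eucl n → ℂ) : ℝ≥0∞ :=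
  eLpNorm (lowProj χ φ) 2 volume
    + ∑' j : ℕ, tp (s * (j + 1)) * eLpNorm (proj χ (j + 1) φ) 2 volume

/-- The supremum over unit vectors, auxiliary notation. -/
def sphSup {n : ℕ} (g : Eucl n → ℝ≥0∞) : ℝ≥0∞ := ⨆ (e : Eucl n) (_ : ‖e‖ = 1), g e

/-- `‖P_j u‖_{M^m_j} = 2^{-(n/2-1/(m-1))j} sup_e ‖P_j u‖_{L^{m-1,∞}_e}`. -/
def MmJ {n : ℕ} (χ : ℝ → ℝ) (m : ℕ) (j : ℤ) (u : ℝ × Eucl n → ℂ) : ℝ≥0∞ :=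
  tp (-((n : ℝ) / 2 - 1 / ((m : ℝ) - 1)) * j)
    * sphSup (fun e => aniNorm ((m : ℝ≥0∞) - 1) ∞ e (projT χ j u))

/-- `‖P_j u‖_{S_j} = 2^{j/2} sup_e ‖P_j Q^{e_±}_{j,20} u‖_{L^{∞,2}_e}`. -/
def SJ {n : ℕ} (ε : Fin n → ℝ) (χ : ℝ → ℝ) (j : ℤ) (u : ℝ × Eucl n → ℂ) : ℝ≥0∞ :=
  tp ((j : ℝ) / 2)
    * sphSup (fun e => aniNorm ∞ 2 e (projT χ j (qprojT χ (epm ε e) j 20 u)))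

/-- `‖P_j u‖_{T_j} = ‖P_j u‖_{L^∞_t L²_x}`. -/
def TJ {n : ℕ} (χ : ℝ → ℝ) (j : ℤ) (u : ℝ × Eucl n → ℂ) : ℝ≥0∞ :=
  mixNorm ∞ 2 (projT χ j u)

/-- `‖P_j u‖_{Y^m_j}`. -/
def YmJ {n : ℕ} (ε : Fin n → ℝ) (χ : ℝ → ℝ) (m : ℕ) (j : ℤ) (u : ℝ × Eucl n → ℂ) : ℝ≥0∞ :=
  MmJ χ m j u + SJ ε χ j u + TJ χ j u

/-- The homogeneous resolution norm `‖u‖_{Ż^σ_{2,1}}`. -/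
def Zhom {n : ℕ} (ε : Fin n → ℝ) (χ : ℝ → ℝ) (m : ℕ) (σ : ℝ) (u : ℝ × Eucl n → ℂ) : ℝ≥0∞ :=
  ∑' j : ℤ, tp (σ * j) * YmJ ε χ m j u

/-- `N_j`-norm of a function: `2^{-j/2} sup_e ‖f‖_{L^{1,2}_e}`. -/
def NJraw {n : ℕ} (j : ℤ) (f : ℝ × Eucl n → ℂ) : ℝ≥0∞ :=
  tp (-(j : ℝ) / 2) * sphSup (fun e => aniNorm 1 2 e f)

/-- `‖P_j u‖_{N_j}`. -/
def NJ {n : ℕ} (χ : ℝ → ℝ) (j : ℤ) (u : ℝ × Eucl n → ℂ) : ℝ≥0∞ :=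
  NJraw j (projT χ j u)

/-- The homogeneous nonlinear norm `‖F‖_{Ṅ^σ_{2,1}}`. -/
def Nhom {n : ℕ} (χ : ℝ → ℝ) (σ : ℝ) (F : ℝ × Eucl n → ℂ) : ℝ≥0∞ :=
  ∑' j : ℤ, tp (σ * j) * NJ χ j F

/-- `‖P_j u‖_{T̃_j} = ‖P_j u‖_{L^∞_t L²_x} + ‖P_j u‖_{L^{2+4/n}_{t,x}}`. -/
def TtilJ {n : ℕ} (χ : ℝ → ℝ) (j : ℤ) (u : ℝ × Eucl n → ℂ) : ℝ≥0∞ :=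
  mixNorm ∞ 2 (projT χ j u)
    + eLpNorm (projT χ j u) (ENNReal.ofReal (2 + 4 / (n : ℝ))) volume

/-- `‖P_j u‖_{M̃_j} = sup_{p ∈ ℤ, p ≥ 2, np ≥ 6} sup_e 2^{(n/2-1/p)j}‖P_j u‖_{L^{p,∞}_e}`. -/
def MtilJ {n : ℕ} (χ : ℝ → ℝ) (j : ℤ) (u : ℝ × Eucl n → ℂ) : ℝ≥0∞ :=
  ⨆ (p : ℕ) (_ : 2 ≤ p ∧ 6 ≤ n * p),
    sphSup (fun e => tp (((n : ℝ) / 2 - 1 / (p : ℝ)) * j) * aniNorm (p : ℝ≥0∞) ∞ e (projT χ j u))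

/-- `‖P_j u‖_{Ỹ_j}`. -/
def YtilJ {n : ℕ} (ε : Fin n → ℝ) (χ : ℝ → ℝ) (j : ℤ) (u : ℝ × Eucl n → ℂ) : ℝ≥0∞ :=
  MtilJ χ j u + SJ ε χ j u + TtilJ χ j u

/-- The inhomogeneous resolution norm `‖u‖_{Z̃^σ_{2,1}}`. -/
def Ztil {n : ℕ} (ε : Fin n → ℝ) (χ : ℝ → ℝ) (σ : ℝ) (u : ℝ × Eucl n → ℂ) : ℝ≥0∞ :=
  (∑' j : ℤ, if j ≤ 0 then YtilJ ε χ j u ^ 2 else 0) ^ ((1 : ℝ) / 2)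
    + ∑' j : ℤ, if 1 ≤ j then tp (σ * j) * YtilJ ε χ j u else 0

/-- `‖f‖_{Ñ_j}`: infimum over decompositions `f = v + w`. -/
def NtilJraw {n : ℕ} (j : ℤ) (f : ℝ × Eucl n → ℂ) : ℝ≥0∞ :=
  ⨅ (vw : (ℝ × Eucl n → ℂ) × (ℝ × Eucl n → ℂ)) (_ : f = vw.1 + vw.2),
    NJraw j vw.1 + eLpNorm vw.2 (ENNReal.ofReal ((2 * (n : ℝ) + 4) / ((n : ℝ) + 4))) volume

/-- The inhomogeneous nonlinear norm `‖F‖_{Ñ^σ_{2,1}}`. -/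
def Ntil {n : ℕ} (χ : ℝ → ℝ) (σ : ℝ) (F : ℝ × Eucl n → ℂ) : ℝ≥0∞ :=
  (∑' j : ℤ, if j ≤ 0 then NtilJraw j (projT χ j F) ^ 2 else 0) ^ ((1 : ℝ) / 2)
    + ∑' j : ℤ, if 1 ≤ j then tp (σ * j) * NtilJraw j (projT χ j F) else 0

/-- `k`-th spatial partial derivative of a space-time function. -/
def pd {n : ℕ} (k : ℕ) (u : ℝ × Eucl n → ℂ) (p : ℝ × Eucl n) : ℂ :=
  if h : k < n then fderiv ℝ (fun y => u (p.1, y)) p.2 (EuclideanSpace.single ⟨k, h⟩ (1 : ℝ))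
  else 0

/-- The retarded Duhamel integral `∫_0^t W_±(t-s) G(s) ds`. -/
def duhamel {n : ℕ} (ε : Fin n → ℝ) (G : ℝ × Eucl n → ℂ) (p : ℝ × Eucl n) : ℂ :=
  ∫ s in (0 : ℝ)..p.1, prop ε (p.1 - s) (fun y => G (s, y)) p.2

/-- Admissible Strichartz pair: `2/q = n(1/2 - 1/r)`, `q, r ≥ 2`, and `q ≠ 2` when `n = 2`. -/
def Admissible (n : ℕ) (q r : ℝ) : Prop :=
  2 / q = (n : ℝ) * (1 / 2 - 1 / r) ∧ 2 ≤ q ∧ 2 ≤ r ∧ (n = 2 → q ≠ 2)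

/-- Value of a power series with coefficients `c` at `z`. -/
def polyVal {d : ℕ} (c : (Fin d →₀ ℕ) → ℂ) (z : Fin d → ℂ) : ℂ :=
  ∑' β : Fin d →₀ ℕ, c β * ∏ i, z i ^ β i

/-- The argument vector `(u, ū, ∇u, ∇ū)` of the general nonlinearity. -/
def nlArg {n : ℕ} (u : ℝ × Eucl n → ℂ) (p : ℝ × Eucl n) (i : Fin (2 * n + 2)) : ℂ :=
  if (i : ℕ) = 0 then u p
  else if (i : ℕ) = 1 then starRingEnd ℂ (u p)
  else if (i : ℕ) < n + 2 then pd ((i : ℕ) - 2) u p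
  else pd ((i : ℕ) - (n + 2)) (fun q => starRingEnd ℂ (u q)) p

/-- The argument vector `(∇u, ∇ū)` of a nonlinearity in `2n` variables. -/
def gradArg {n : ℕ} (u : ℝ × Eucl n → ℂ) (p : ℝ × Eucl n) (i : Fin (2 * n)) : ℂ :=
  if (i : ℕ) < n then pd (i : ℕ) u p
  else pd ((i : ℕ) - n) (fun q => starRingEnd ℂ (u q)) p

end DNLS
open DNLS

section PartialFourier
open scoped SchwartzMap

variable {D E V : Type} [NormedAddCommGroup D] [NormedSpace ℝ D]
  [NormedAddCommGroup E] [InnerProductSpace ℝ E] [FiniteDimensional ℝ E] [MeasurableSpace E]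
  [BorelSpace E] [NormedAddCommGroup V] [NormedSpace ℂ V]

/-- The Fourier transform in the second variable. -/
def partialFourier (A : 𝓢(D × E, V)) (p : D × E) : V := 𝓕 (fun x => A (p.1, x)) p.2

/-- The Schwartz function whose partial Fourier transform is the derivative of that of `A`. -/
def partialFourierDeriv (A : 𝓢(D × E, V)) : 𝓢(D × E, D × E →L[ℝ] V) :=
  SchwartzMap.postcompCLM (𝕜 := ℝ) (ContinuousLinearMap.precomp V
      ((ContinuousLinearMap.inl ℝ D E).comp (ContinuousLinearMap.fst ℝ D E)))
      (SchwartzMap.fderivCLM ℝ (D × E) V A)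
    + (-(2 * (Real.pi : ℂ) * I)) • SchwartzMap.smulRightCLM ℂ V
      (((innerSL ℝ (E := E)).bilinearComp (ContinuousLinearMap.snd ℝ D E) (ContinuousLinearMap.snd ℝ D E))) A

lemma SchwartzMap.exists_decay_snd {E' : Type} [NormedAddCommGroup E'] [NormedSpace ℝ E']
    {V : Type} [NormedAddCommGroup V] [NormedSpace ℝ V] (A : 𝓢(D × E', V)) (l N : ℕ) :
    ∃ C, 0 ≤ C ∧ ∀ d x, ‖d‖ ^ l * ‖A (d, x)‖ ≤ C * (1 + ‖x‖) ^ (-(N : ℝ)) := by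
  refine ⟨2 ^ (l + N) * (Finset.Iic (l + N, 0)).sup (fun m => SchwartzMap.seminorm ℝ m.1 m.2) A,
    by positivity, fun d x => ?_⟩
  · have h := SchwartzMap.one_add_le_sup_seminorm_apply (𝕜 := ℝ) (m := (l + N, 0)) (k := l + N)
      (n := 0) le_rfl le_rfl A (d, x)
    have hx : 0 < 1 + ‖x‖ := by positivity
    rw [Real.rpow_neg hx.le, ← div_eq_mul_inv, le_div_iff₀ (by positivity), Real.rpow_natCast]
    refine le_trans ?_ h
    rw [norm_iteratedFDeriv_zero, pow_add]
    have h1 : ‖d‖ ≤ 1 + ‖(d, x)‖ := by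
      have := norm_fst_le (d, x); simp only at this; linarith
    have h2 : 1 + ‖x‖ ≤ 1 + ‖(d, x)‖ := by
      have := norm_snd_le (d, x); simp only at this; linarith
    calc ‖d‖ ^ l * ‖A (d, x)‖ * (1 + ‖x‖) ^ N = ‖d‖ ^ l * (1 + ‖x‖) ^ N * ‖A (d, x)‖ := by ring
      _ ≤ _ := by gcongr

lemma integrable_one_add_norm_finrank :
    Integrable (fun x : E => (1 + ‖x‖) ^ (-((Module.finrank ℝ E + 1 : ℕ) : ℝ))) :=
  integrable_one_add_norm (by push_cast; linarith)

lemma SchwartzMap.integrable_slice (A : 𝓢(D × E, V)) (d : D) :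
    Integrable (fun x => A (d, x)) := by
  obtain ⟨C, hC, h⟩ := A.exists_decay_snd 0 (Module.finrank ℝ E + 1)
  refine (integrable_one_add_norm_finrank.const_mul C).mono'
    (by have := A.continuous; exact Continuous.aestronglyMeasurable (by fun_prop)) (.of_forall fun x => ?_)
  simpa using h d x

lemma partialFourier_apply (A : 𝓢(D × E, V)) (p : D × E) :
    partialFourier A p = ∫ x : E, cexp (((2 * Real.pi * (-⟪x, p.2⟫) : ℝ) : ℂ) * I) • A (p.1, x) := by
  rw [partialFourier, Real.fourier_eq]
  rfl

lemma hasFDerivAt_partialFourier (A : 𝓢(D × E, V)) (p : D × E) :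
    HasFDerivAt (partialFourier A) (partialFourier (V := D × E →L[ℝ] V) (partialFourierDeriv A) p) p := by
  obtain ⟨C, hC, h⟩ := (partialFourierDeriv A).exists_decay_snd 0 (Module.finrank ℝ E + 1)
  have hfun : partialFourier A = fun p : D × E =>
    ∫ x : E, cexp (((2 * Real.pi * (-⟪x, p.2⟫) : ℝ) : ℂ) * I) • A (p.1, x) :=
      funext (partialFourier_apply A)
  have hA := A.continuous
  have hB := (partialFourierDeriv A).continuous
  rw [partialFourier_apply (V := D × E →L[ℝ] V), hfun]
  refine hasFDerivAt_integral_of_dominated_of_fderiv_le (𝕜 := ℝ)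
    (F := fun (p : D × E) (x : E) => cexp (((2 * Real.pi * (-⟪x, p.2⟫) : ℝ) : ℂ) * I) • A (p.1, x))
    (F' := fun p x => cexp (((2 * Real.pi * (-⟪x, p.2⟫) : ℝ) : ℂ) * I) • partialFourierDeriv A (p.1, x))
    (bound := fun x => C * (1 + ‖x‖) ^ (-((Module.finrank ℝ E + 1 : ℕ) : ℝ)))
    Filter.univ_mem ?_ ?_ ?_ ?_ ?_ ?_
  · exact .of_forall fun p => Continuous.aestronglyMeasurable (by fun_prop)
  · refine (A.integrable_slice p.1).mono (Continuous.aestronglyMeasurable (by fun_prop))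
      (.of_forall fun x => ?_)
    rw [norm_smul, Complex.norm_exp_ofReal_mul_I, one_mul]
  · exact Continuous.aestronglyMeasurable (by fun_prop)
  · refine .of_forall fun x p _ => ?_
    rw [norm_smul, Complex.norm_exp_ofReal_mul_I, one_mul]
    simpa using h p.1 x
  · exact integrable_one_add_norm_finrank.const_mul C
  · refine .of_forall fun x p _ => ?_
    have h1 : HasFDerivAt (fun p : D × E => A (p.1, x))
        ((fderiv ℝ A (p.1, x)).comp ((ContinuousLinearMap.inl ℝ D E).comp (ContinuousLinearMap.fst ℝ D E))) p := by
      refine (A.differentiableAt (x := (p.1, x))).hasFDerivAt.comp p ?_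
      have := (hasFDerivAt_fst (𝕜 := ℝ) (p := p)).prodMk (hasFDerivAt_const x p)
      exact this.congr_fderiv (by ext <;> simp)
    have h2 : HasFDerivAt (fun p : D × E => (((2 * Real.pi * (-⟪x, p.2⟫) : ℝ) : ℂ) * I))
        (I • ofRealCLM.comp ((-(2 * Real.pi)) • (innerSL ℝ x).comp (ContinuousLinearMap.snd ℝ D E))) p := by
      have := (I • ofRealCLM.comp ((-(2 * Real.pi)) •
        (innerSL ℝ x).comp (ContinuousLinearMap.snd ℝ D E))).hasFDerivAt (x := p)
      refine this.congr_of_eventuallyEq (.of_forall fun q => ?_)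
      simp; ring
    refine (h2.cexp.smul h1).congr_fderiv ?_
    ext q
    · simp [partialFourierDeriv, SchwartzMap.postcompCLM_apply, SchwartzMap.smulRightCLM_apply_apply]
    · simp [partialFourierDeriv, SchwartzMap.postcompCLM_apply, SchwartzMap.smulRightCLM_apply_apply, smul_smul]
      rw [← Complex.coe_smul ⟪x, q⟫ (A (p.1, x)), smul_smul]
      congr 1
      ring


variable [CompleteSpace V]

/-- The derivative in the second variable. -/
def spatialDeriv (A : 𝓢(D × E, V)) : 𝓢(D × E, E →L[ℝ] V) :=
  SchwartzMap.postcompCLM (𝕜 := ℝ) (ContinuousLinearMap.precomp V (ContinuousLinearMap.inr ℝ D E))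
      (SchwartzMap.fderivCLM ℝ (D × E) V A)

lemma SchwartzMap.hasFDerivAt_slice (A : 𝓢(D × E, V)) (d : D) (x : E) :
    HasFDerivAt (fun x => A (d, x)) (spatialDeriv A (d, x)) x := by
  have := (A.differentiableAt (x := (d, x))).hasFDerivAt.comp x
    (((hasFDerivAt_const d x).prodMk (hasFDerivAt_id (𝕜 := ℝ) x)))
  refine this.congr_fderiv ?_
  ext; simp [spatialDeriv, SchwartzMap.postcompCLM_apply]

lemma norm_partialFourier_spatialDeriv (A : 𝓢(D × E, V)) (d : D) (ξ : E) :
    ‖partialFourier (V := E →L[ℝ] V) (spatialDeriv A) (d, ξ)‖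
      = 2 * Real.pi * ‖ξ‖ * ‖partialFourier A (d, ξ)‖ := by
  have h : fderiv ℝ (fun x => A (d, x)) = fun x => spatialDeriv A (d, x) :=
    funext fun x => (A.hasFDerivAt_slice d x).fderiv
  have key := Real.fourier_fderiv (A.integrable_slice d)
    (fun x => (A.hasFDerivAt_slice d x).differentiableAt)
    (by rw [h]; exact SchwartzMap.integrable_slice (V := E →L[ℝ] V) _ d)
  rw [h] at key
  simp only [partialFourier, key]
  rw [VectorFourier.norm_fourierSMulRight]
  rw [neg_apply, norm_neg, innerSL_apply_norm]

lemma partialFourier_decay_aux (l : ℕ) : ∀ (k : ℕ) (V : Type) [NormedAddCommGroup V] [NormedSpace ℂ V]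
    [CompleteSpace V] (A : 𝓢(D × E, V)),
    ∃ C, ∀ d ξ, ‖d‖ ^ l * ‖ξ‖ ^ k * ‖partialFourier A (d, ξ)‖ ≤ C := by
  intro k
  induction k with
  | zero =>
    intro V _ _ _ A
    obtain ⟨C, hC, h⟩ := A.exists_decay_snd l (Module.finrank ℝ E + 1)
    refine ⟨∫ x : E, C * (1 + ‖x‖) ^ (-((Module.finrank ℝ E + 1 : ℕ) : ℝ)), fun d ξ => ?_⟩
    rw [partialFourier, pow_zero, mul_one]
    calc ‖d‖ ^ l * ‖𝓕 (fun x => A (d, x)) ξ‖ ≤ ‖d‖ ^ l * ∫ x, ‖A (d, x)‖ := by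
          gcongr; exact VectorFourier.norm_fourierIntegral_le_integral_norm _ _ _ _ _
      _ = ∫ x, ‖d‖ ^ l * ‖A (d, x)‖ := (integral_const_mul _ _).symm
      _ ≤ _ := integral_mono ((A.integrable_slice d).norm.const_mul _)
          (integrable_one_add_norm_finrank.const_mul C) (h d)
  | succ k ih =>
    intro V _ _ _ A
    obtain ⟨C, hC⟩ := ih (E →L[ℝ] V) (spatialDeriv A)
    refine ⟨C / (2 * Real.pi), fun d ξ => ?_⟩
    have := hC d ξ
    rw [norm_partialFourier_spatialDeriv] at this
    rw [le_div_iff₀ (by positivity)]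
    refine le_trans (le_of_eq ?_) this
    ring

lemma partialFourier_decay (k : ℕ) (A : 𝓢(D × E, V)) :
    ∃ C, ∀ p, ‖p‖ ^ k * ‖partialFourier A p‖ ≤ C := by
  obtain ⟨C₁, h₁⟩ := partialFourier_decay_aux k 0 V A
  obtain ⟨C₂, h₂⟩ := partialFourier_decay_aux 0 k V A
  refine ⟨C₁ + C₂, fun p => ?_⟩
  have h₁ := h₁ p.1 p.2
  have h₂ := h₂ p.1 p.2
  simp only [pow_zero, mul_one, one_mul, Prod.mk.eta] at h₁ h₂
  have : ‖p‖ ^ k ≤ ‖p.1‖ ^ k + ‖p.2‖ ^ k := by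
    rw [Prod.norm_def]
    rcases max_choice ‖p.1‖ ‖p.2‖ with h | h <;> rw [h]
    · linarith [pow_nonneg (norm_nonneg p.2) k]
    · linarith [pow_nonneg (norm_nonneg p.1) k]
  nlinarith [norm_nonneg (partialFourier A p)]

lemma fderiv_partialFourier (A : 𝓢(D × E, V)) :
    fderiv ℝ (partialFourier A) = partialFourier (V := D × E →L[ℝ] V) (partialFourierDeriv A) :=
  funext fun p => (hasFDerivAt_partialFourier A p).fderiv

lemma contDiff_partialFourier_aux (m : ℕ) : ∀ (V : Type) [NormedAddCommGroup V] [NormedSpace ℂ V]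
    [CompleteSpace V] (A : 𝓢(D × E, V)), ContDiff ℝ m (partialFourier A) := by
  induction m with
  | zero =>
    intro V _ _ _ A
    exact contDiff_zero.2 (continuous_iff_continuousAt.2 fun p => (hasFDerivAt_partialFourier A p).continuousAt)
  | succ m ih =>
    intro V _ _ _ A
    push_cast
    refine contDiff_succ_iff_fderiv.2 ⟨fun p => (hasFDerivAt_partialFourier A p).differentiableAt, by simp, ?_⟩
    rw [fderiv_partialFourier]
    exact ih (D × E →L[ℝ] V) _

lemma partialFourier_decay_iterated (k m : ℕ) : ∀ (V : Type) [NormedAddCommGroup V] [NormedSpace ℂ V]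
    [CompleteSpace V] (A : 𝓢(D × E, V)),
    ∃ C, ∀ p, ‖p‖ ^ k * ‖iteratedFDeriv ℝ m (partialFourier A) p‖ ≤ C := by
  induction m with
  | zero =>
    intro V _ _ _ A
    simpa using partialFourier_decay k A
  | succ m ih =>
    intro V _ _ _ A
    obtain ⟨C, hC⟩ := ih (D × E →L[ℝ] V) (partialFourierDeriv A)
    refine ⟨C, fun p => ?_⟩
    rw [← norm_iteratedFDeriv_fderiv, fderiv_partialFourier]
    exact hC p

/-- The Fourier transform in the second variable, as a Schwartz function. -/
def partialFourierSchwartz (A : 𝓢(D × E, V)) : 𝓢(D × E, V) where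
  toFun := partialFourier A
  smooth' := contDiff_infty.2 fun m => contDiff_partialFourier_aux m V A
  decay' k m := partialFourier_decay_iterated k m V A

lemma partialFourierSchwartz_apply (A : 𝓢(D × E, V)) (d : D) (ξ : E) :
    partialFourierSchwartz A (d, ξ) = 𝓕 (fun x => A (d, x)) ξ := rfl

/-- The inverse Fourier transform in the second variable, as a Schwartz function. -/
def partialFourierInvSchwartz (A : 𝓢(D × E, V)) : 𝓢(D × E, V) :=
  SchwartzMap.compCLMOfContinuousLinearEquiv ℝ
    ((ContinuousLinearEquiv.refl ℝ D).prodCongr (ContinuousLinearEquiv.neg ℝ)) (partialFourierSchwartz A)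

lemma partialFourierInvSchwartz_apply (A : 𝓢(D × E, V)) (d : D) (ξ : E) :
    partialFourierInvSchwartz A (d, ξ) = 𝓕⁻ (fun x => A (d, x)) ξ := by
  rw [Real.fourierInv_eq_fourier_neg]; rfl

end PartialFourier

section Plancherel
open scoped SchwartzMap
variable {E : Type} [NormedAddCommGroup E] [InnerProductSpace ℝ E] [FiniteDimensional ℝ E] [MeasurableSpace E]
  [BorelSpace E]

lemma fourier_ae_eq_Lp_fourier {f : E → ℂ} (h1 : Integrable f) (h2 : MemLp f 2) :
    𝓕 f =ᵐ[volume] (𝓕 (h2.toLp f) : Lp (α := E) ℂ 2) := by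
  have hc : Continuous (𝓕 f) := VectorFourier.fourierIntegral_continuous
    Real.continuous_fourierChar (by simpa using continuous_inner) h1
  refine ae_eq_of_integral_contDiff_smul_eq (hc.locallyIntegrable)
    ((Lp.memLp _).locallyIntegrable (by norm_num)) fun g hg hgc => ?_
  let G : 𝓢(E, ℂ) := HasCompactSupport.toSchwartzMap (f := fun x => (g x : ℂ))
    (hgc.comp_left (g := fun r : ℝ => (r : ℂ)) (by simp)) (Complex.ofRealCLM.contDiff.comp hg)
  have hG : ∀ x, G x = g x := fun x => rfl
  have key := congrArg (fun T => T G) (Lp.fourier_toTemperedDistribution_eq (h2.toLp f))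
  simp only [TemperedDistribution.fourier_apply, Lp.toTemperedDistribution_apply] at key
  have flip := VectorFourier.integral_fourierIntegral_smul_eq_flip (f := (G : E → ℂ)) (g := f) (μ := volume)
    (ν := volume) (L := innerₗ E) Real.continuous_fourierChar (by simpa using continuous_inner) G.integrable h1
  calc ∫ x, g x • 𝓕 f x = ∫ x, G x • 𝓕 f x := by simp [hG]
    _ = ∫ x, (𝓕 G) x • f x := by
      rw [flip_innerₗ] at flip
      exact flip.symm
    _ = ∫ x, (𝓕 G) x • (h2.toLp f) x := by
      refine integral_congr_ae ?_
      filter_upwards [h2.coeFn_toLp] with x hx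
      rw [hx]
    _ = _ := by rw [key]; simp [hG]

lemma eLpNorm_fourier {f : E → ℂ} (h1 : Integrable f) (h2 : MemLp f 2) :
    eLpNorm (𝓕 f) 2 volume = eLpNorm f 2 volume := by
  have h := Lp.norm_fourier_eq (h2.toLp f)
  rw [eLpNorm_congr_ae (fourier_ae_eq_Lp_fourier h1 h2), ← eLpNorm_congr_ae h2.coeFn_toLp]
  rw [Lp.norm_def, Lp.norm_def, ENNReal.toReal_eq_toReal_iff' (Lp.eLpNorm_ne_top _) (Lp.eLpNorm_ne_top _)] at h
  exact h

lemma eLpNorm_two_sq {α : Type*} [MeasurableSpace α] {μ : Measure α} (f : α → ℂ) :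
    eLpNorm f 2 μ ^ 2 = ∫⁻ x, ‖f x‖ₑ ^ 2 ∂μ := by
  have := eLpNorm_nnreal_pow_eq_lintegral (μ := μ) (f := f) (p := 2) (by norm_num)
  norm_cast at this ⊢
  simpa using this

lemma lintegral_enorm_fourier_sq {f : E → ℂ} (h1 : Integrable f) (h2 : MemLp f 2) :
    ∫⁻ x, ‖𝓕 f x‖ₑ ^ 2 = ∫⁻ x, ‖f x‖ₑ ^ 2 := by
  rw [← eLpNorm_two_sq, ← eLpNorm_two_sq, eLpNorm_fourier h1 h2]

lemma lintegral_enorm_fourierInv_sq_le {f : E → ℂ} (h1 : Integrable f) :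
    ∫⁻ x, ‖𝓕⁻ f x‖ₑ ^ 2 ≤ ∫⁻ x, ‖f x‖ₑ ^ 2 := by
  by_cases h : eLpNorm f 2 volume = ⊤
  · rw [← eLpNorm_two_sq f, h]; simp
  have h2 : MemLp f 2 := ⟨h1.1, lt_top_iff_ne_top.2 h⟩
  have hn := Measure.measurePreserving_neg (volume : Measure E)
  have h3 := lintegral_enorm_fourier_sq (f := fun x => f (-x)) h1.comp_neg
    (h2.comp_measurePreserving hn)
  rw [Real.fourierInv_eq_fourier_comp_neg, h3]
  exact (lintegral_neg_eq_self (fun x => ‖f x‖ₑ ^ 2)).le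

end Plancherel

section Minkowski

lemma lintegral_lintegral_sq_le {X Y : Type*} [MeasurableSpace X] [MeasurableSpace Y] (μ : Measure X)
    (ν : Measure Y) [SFinite μ] [SFinite ν] {F : X → Y → ℝ≥0∞} (hF : Measurable (Function.uncurry F)) :
    ∫⁻ x, (∫⁻ y, F x y ∂ν) ^ 2 ∂μ ≤ (∫⁻ y, (∫⁻ x, F x y ^ 2 ∂μ) ^ (1 / 2 : ℝ) ∂ν) ^ 2 := by
  have hx : ∀ x, Measurable (F x) := fun x => hF.of_uncurry_left
  have hy : ∀ y, Measurable (fun x => F x y) := fun y => hF.of_uncurry_right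
  have hF1 : Measurable fun p : (X × Y) × Y => F p.1.1 p.1.2 * F p.1.1 p.2 :=
    (hF.comp (by fun_prop : Measurable fun p : (X × Y) × Y => (p.1.1, p.1.2))).mul
      (hF.comp (by fun_prop : Measurable fun p : (X × Y) × Y => (p.1.1, p.2)))
  have hF2 : Measurable fun p : (Y × X) × Y => F p.1.2 p.1.1 * F p.1.2 p.2 :=
    (hF.comp (by fun_prop : Measurable fun p : (Y × X) × Y => (p.1.2, p.1.1))).mul
      (hF.comp (by fun_prop : Measurable fun p : (Y × X) × Y => (p.1.2, p.2)))
  have e1 : ∀ x, (∫⁻ y, F x y ∂ν) ^ 2 = ∫⁻ y, ∫⁻ z, F x y * F x z ∂ν ∂ν := fun x => by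
    rw [sq, ← lintegral_mul_const _ (hx x)]
    exact lintegral_congr fun y => (lintegral_const_mul _ (hx x)).symm
  have hm : Measurable fun y => (∫⁻ x, F x y ^ 2 ∂μ) ^ (1 / 2 : ℝ) := by
    refine Measurable.pow_const (Measurable.lintegral_prod_left' (f := fun p : X × Y => F p.1 p.2 ^ 2) ?_) _
    exact hF.pow_const 2
  simp_rw [e1]
  rw [lintegral_lintegral_swap (f := fun x y => ∫⁻ z, F x y * F x z ∂ν)
    (Measurable.lintegral_prod_right' hF1).aemeasurable]
  rw [sq, ← lintegral_mul_const _ hm]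
  refine lintegral_mono fun y => ?_
  rw [← lintegral_const_mul _ hm]
  dsimp only
  rw [lintegral_lintegral_swap (f := fun x z => F x y * F x z)
    (hF1.comp (by fun_prop : Measurable fun p : X × Y => ((p.1, y), p.2))).aemeasurable]
  refine lintegral_mono fun z => ?_
  have := ENNReal.lintegral_mul_le_Lp_mul_Lq μ Real.HolderConjugate.two_two (hy y).aemeasurable (hy z).aemeasurable
  simpa using this

end Minkowski

section Volterra
open scoped Convolution

lemma memLp_two_of_integrable_of_bound {α : Type*} [MeasurableSpace α] {μ : Measure α} {f : α → ℂ}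
    (hf : Integrable f μ) {B : ℝ} (hB : ∀ x, ‖f x‖ ≤ B) : MemLp f 2 μ := by
  refine ⟨hf.1, ?_⟩
  have h : ∫⁻ x, ‖f x‖ₑ ^ 2 ∂μ < ⊤ := by
    calc ∫⁻ x, ‖f x‖ₑ ^ 2 ∂μ ≤ ∫⁻ x, ENNReal.ofReal B * ‖f x‖ₑ ∂μ := by
          refine lintegral_mono fun x => ?_
          rw [sq, ← ofReal_norm]
          gcongr
          exact hB x
      _ = ENNReal.ofReal B * ∫⁻ x, ‖f x‖ₑ ∂μ := lintegral_const_mul' _ _ ENNReal.ofReal_ne_top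
      _ < ⊤ := ENNReal.mul_lt_top ENNReal.ofReal_lt_top hf.2
  rw [← eLpNorm_two_sq] at h
  by_contra hc
  rw [not_lt_top_iff] at hc
  simp [hc] at h

lemma volterra_sq_le_pos {K f : ℝ → ℂ} (hK : Continuous K) {M : ℝ} (hM : ∀ θ, ‖K θ‖ ≤ M)
    (hfi : Integrable f) (hf2 : MemLp f 2) {A : ℝ}
    (hA : ∀ δ : ℝ, 0 < δ → ∀ τ : ℝ,
      ‖∫ θ in Set.Ioi (0 : ℝ), cexp (-(2 * Real.pi * τ * I) * θ) * (cexp (-δ * θ) * K θ)‖ ≤ A) :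
    ∫⁻ t in Set.Ioi (0 : ℝ), ‖∫ s in (0 : ℝ)..t, K (t - s) * f s‖ₑ ^ 2
      ≤ ENNReal.ofReal A ^ 2 * ∫⁻ s in Set.Ioi (0 : ℝ), ‖f s‖ₑ ^ 2 := by
  have hM0 : 0 ≤ M := (norm_nonneg _).trans (hM 0)
  let Kd : ℝ → ℝ → ℂ := fun δ => (Set.Ioi (0 : ℝ)).indicator (fun θ => cexp (-δ * θ) * K θ)
  let fd : ℝ → ℝ → ℂ := fun δ => (Set.Ioi (0 : ℝ)).indicator (fun θ => cexp (-δ * θ) * f θ)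
  have hexp : ∀ δ > 0, ∀ θ ∈ Set.Ioi (0 : ℝ), ‖cexp (-(δ : ℝ) * (θ : ℝ))‖ = Real.exp (-δ * θ) := by
    intro δ _ θ _
    rw [Complex.norm_exp]; simp
  have hexp1 : ∀ δ > 0, ∀ θ ∈ Set.Ioi (0 : ℝ), ‖cexp (-(δ : ℝ) * (θ : ℝ))‖ ≤ 1 := by
    intro δ hδ θ hθ
    rw [hexp δ hδ θ hθ, Real.exp_le_one_iff]
    have : (0 : ℝ) < θ := hθ
    nlinarith
  have hKn : ∀ δ > 0, ∀ θ, ‖Kd δ θ‖ ≤ M := by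
    intro δ hδ θ
    by_cases hθ : θ ∈ Set.Ioi (0 : ℝ)
    · simp only [Kd, Set.indicator_of_mem hθ, norm_mul]
      nlinarith [hexp1 δ hδ θ hθ, hM θ, norm_nonneg (K θ), norm_nonneg (cexp (-(δ : ℝ) * (θ : ℝ)))]
    · simpa only [Kd, Set.indicator_of_notMem hθ, norm_zero]
  have hKi : ∀ δ > 0, Integrable (Kd δ) := by
    intro δ hδ
    rw [integrable_indicator_iff measurableSet_Ioi]
    refine ((exp_neg_integrableOn_Ioi 0 hδ).const_mul M).mono'
      (Continuous.aestronglyMeasurable (by fun_prop)) ?_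
    refine (ae_restrict_mem measurableSet_Ioi).mono fun θ hθ => ?_
    rw [norm_mul, hexp δ hδ θ hθ, mul_comm]
    gcongr
    exact hM θ
  have hfn : ∀ δ > 0, ∀ θ, ‖fd δ θ‖ ≤ ‖f θ‖ := by
    intro δ hδ θ
    by_cases hθ : θ ∈ Set.Ioi (0 : ℝ)
    · simp only [fd, Set.indicator_of_mem hθ, norm_mul]
      exact mul_le_of_le_one_left (norm_nonneg _) (hexp1 δ hδ θ hθ)
    · simp only [fd, Set.indicator_of_notMem hθ, norm_zero, norm_nonneg]
  have hfm : ∀ δ, AEStronglyMeasurable (fd δ) := fun δ => by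
    refine AEStronglyMeasurable.indicator (AEStronglyMeasurable.mul ?_ hfi.1) measurableSet_Ioi
    exact Continuous.aestronglyMeasurable (by fun_prop)
  have hfdi : ∀ δ > 0, Integrable (fd δ) := fun δ hδ =>
    hfi.mono (hfm δ) (.of_forall (hfn δ hδ))
  have hfd2 : ∀ δ > 0, MemLp (fd δ) 2 := fun δ hδ =>
    hf2.mono (hfm δ) (.of_forall (hfn δ hδ))
  let h : ℝ → ℝ → ℂ := fun δ => (fd δ) ⋆[ContinuousLinearMap.mul ℂ ℂ] (Kd δ)
  have hhi : ∀ δ > 0, Integrable (h δ) := fun δ hδ =>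
    (hfdi δ hδ).integrable_convolution _ (hKi δ hδ)
  have hhb : ∀ δ > 0, ∀ t, ‖h δ t‖ ≤ ∫ s, ‖f s‖ * M := by
    intro δ hδ t
    refine norm_integral_le_of_norm_le (hfi.norm.mul_const M) (.of_forall fun s => ?_)
    simp only [ContinuousLinearMap.mul_apply', norm_mul]
    exact mul_le_mul (hfn δ hδ s) (hKn δ hδ _) (norm_nonneg _) (norm_nonneg _)
  have hhv : ∀ δ > 0, ∀ t > 0, h δ t = cexp (-δ * t) * ∫ s in (0 : ℝ)..t, K (t - s) * f s := by
    intro δ hδ t ht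
    rw [intervalIntegral.integral_of_le ht.le, ← integral_Ioc_eq_integral_Ioo.symm, ← integral_const_mul,
      ← integral_indicator measurableSet_Ioo]
    refine integral_congr_ae (.of_forall fun s => ?_)
    simp only [ContinuousLinearMap.mul_apply', fd, Kd, Set.indicator_apply, Set.mem_Ioi, Set.mem_Ioo, sub_pos]
    by_cases h1 : 0 < s <;> by_cases h2 : s < t <;>
      simp only [h1, h2, if_true, if_false, and_self, and_true, and_false, zero_mul, mul_zero]
    have : cexp (-δ * t) = cexp (-δ * s) * cexp (-δ * (t - s : ℝ)) := by
      rw [← Complex.exp_add]; push_cast; ring_nf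
    rw [this]; ring
  have hbound : ∀ δ > 0, ∫⁻ t, ‖h δ t‖ₑ ^ 2 ≤ ENNReal.ofReal A ^ 2 * ∫⁻ s in Set.Ioi (0 : ℝ), ‖f s‖ₑ ^ 2 := by
    intro δ hδ
    rw [← lintegral_enorm_fourier_sq (hhi δ hδ) (memLp_two_of_integrable_of_bound (hhi δ hδ) (hhb δ hδ))]
    calc ∫⁻ τ, ‖𝓕 (h δ) τ‖ₑ ^ 2 ≤ ∫⁻ τ, ENNReal.ofReal A ^ 2 * ‖𝓕 (fd δ) τ‖ₑ ^ 2 := by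
          refine lintegral_mono fun τ => ?_
          dsimp only
          rw [Real.fourier_mul_convolution_eq (hfdi δ hδ) (hKi δ hδ), enorm_mul, mul_pow, mul_comm]
          gcongr
          rw [← ofReal_norm]
          refine ENNReal.ofReal_le_ofReal (le_trans (le_of_eq ?_) (hA δ hδ τ))
          rw [Real.fourier_real_eq_integral_exp_smul, ← integral_indicator measurableSet_Ioi]
          congr 2
          ext θ
          by_cases hθ : θ ∈ Set.Ioi (0 : ℝ)
          · simp only [Kd, Set.indicator_of_mem hθ, smul_eq_mul]
            congr 2; push_cast; ring
          · simp only [Kd, Set.indicator_of_notMem hθ, smul_zero]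
      _ = ENNReal.ofReal A ^ 2 * ∫⁻ s, ‖fd δ s‖ₑ ^ 2 := by
          rw [lintegral_const_mul' _ _ (ENNReal.pow_ne_top ENNReal.ofReal_ne_top),
            lintegral_enorm_fourier_sq (hfdi δ hδ) (hfd2 δ hδ)]
      _ ≤ _ := by
          refine mul_le_mul_right ?_ _
          rw [← lintegral_indicator measurableSet_Ioi]
          refine lintegral_mono fun s => ?_
          by_cases hs : s ∈ Set.Ioi (0 : ℝ)
          · rw [Set.indicator_of_mem hs]
            gcongr
            exact enorm_le_iff_norm_le.2 (hfn δ hδ s)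
          · simp [fd, Set.indicator_of_notMem hs]
  let d : ℕ → ℝ := fun n => 1 / (n + 1 : ℝ)
  have hd0 : ∀ n, 0 < d n := fun n => by positivity
  have hd : Tendsto d atTop (𝓝 0) := tendsto_one_div_add_atTop_nhds_zero_nat
  calc ∫⁻ t in Set.Ioi (0 : ℝ), ‖∫ s in (0 : ℝ)..t, K (t - s) * f s‖ₑ ^ 2
      = ∫⁻ t in Set.Ioi (0 : ℝ), liminf (fun n => ‖h (d n) t‖ₑ ^ 2) atTop := by
        refine setLIntegral_congr_fun measurableSet_Ioi fun t ht => ?_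
        refine (Tendsto.liminf_eq ?_).symm
        have h1 : Tendsto (fun n => h (d n) t) atTop (𝓝 (∫ s in (0 : ℝ)..t, K (t - s) * f s)) := by
          have : (fun n => h (d n) t) = fun n => cexp (-(d n : ℝ) * t) * ∫ s in (0 : ℝ)..t, K (t - s) * f s :=
            funext fun n => hhv _ (hd0 n) t ht
          rw [this]
          have hcont : Continuous fun x : ℝ => cexp (-(x : ℝ) * t) * ∫ s in (0 : ℝ)..t, K (t - s) * f s := by
            fun_prop
          have := (hcont.tendsto 0).comp hd
          simpa [Function.comp_def] using this
        exact ((ENNReal.continuous_pow 2).tendsto _).comp h1.enorm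
    _ ≤ liminf (fun n => ∫⁻ t in Set.Ioi (0 : ℝ), ‖h (d n) t‖ₑ ^ 2) atTop :=
        lintegral_liminf_le' fun n => ((hhi _ (hd0 n)).1.enorm.pow_const 2).restrict
    _ ≤ _ := by
        refine liminf_le_of_le (by isBoundedDefault) fun b hb => ?_
        obtain ⟨n, hn⟩ := hb.exists
        exact hn.trans ((setLIntegral_le_lintegral _ _).trans (hbound _ (hd0 n)))

lemma volterra_sq_le {K f : ℝ → ℂ} (hK : Continuous K) {M : ℝ} (hM : ∀ θ, ‖K θ‖ ≤ M)
    (hfi : Integrable f) (hf2 : MemLp f 2) {A : ℝ}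
    (hA : ∀ σ : ℝ, (σ = 1 ∨ σ = -1) → ∀ δ : ℝ, 0 < δ → ∀ τ : ℝ,
      ‖∫ θ in Set.Ioi (0 : ℝ), cexp (-(2 * Real.pi * τ * I) * θ) * (cexp (-δ * θ) * K (σ * θ))‖ ≤ A) :
    ∫⁻ t, ‖∫ s in (0 : ℝ)..t, K (t - s) * f s‖ₑ ^ 2
      ≤ ENNReal.ofReal A ^ 2 * ∫⁻ s, ‖f s‖ₑ ^ 2 := by
  have h1 := volterra_sq_le_pos hK hM hfi hf2 (A := A) (by simpa using hA 1 (Or.inl rfl))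
  have h2 := volterra_sq_le_pos (K := fun θ => K (-θ)) (f := fun θ => f (-θ)) (by fun_prop)
    (fun θ => hM _) hfi.comp_neg
    (hf2.comp_measurePreserving (Measure.measurePreserving_neg volume)) (A := A)
    (by simpa using hA (-1) (Or.inr rfl))
  have e0 : ∀ g : ℝ → ℝ≥0∞, ∫⁻ t in Set.Ioi (0 : ℝ), g (-t) = ∫⁻ t in Set.Iio (0 : ℝ), g t := by
    intro g
    have := (Measure.measurePreserving_neg (volume : Measure ℝ)).setLIntegral_comp_preimage_emb
      (MeasurableEquiv.neg ℝ).measurableEmbedding g (Set.Iio 0)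
    simpa using this
  have e1 : ∀ t : ℝ, ∫ s in (0 : ℝ)..t, K (-(t - s)) * f (-s) = - ∫ s in (0 : ℝ)..(-t), K (-t - s) * f s := by
    intro t
    rw [← intervalIntegral.integral_symm]
    have := intervalIntegral.integral_comp_neg (a := 0) (b := t) (fun s => K (-t - s) * f s)
    simp only [neg_zero] at this
    rw [← this]
    congr 1; ext s; congr 2; ring
  simp only [e1, enorm_neg] at h2
  rw [e0 (fun t => ‖∫ s in (0 : ℝ)..t, K (t - s) * f s‖ₑ ^ 2), e0 (fun s => ‖f s‖ₑ ^ 2)] at h2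
  have e2 : ∀ g : ℝ → ℝ≥0∞, ∫⁻ t, g t = (∫⁻ t in Set.Ioi (0 : ℝ), g t) + ∫⁻ t in Set.Iio (0 : ℝ), g t := by
    intro g
    rw [← lintegral_add_compl g (measurableSet_Ioi (a := (0 : ℝ))), Set.compl_Ioi,
      Measure.restrict_congr_set Iio_ae_eq_Iic]
  rw [e2, e2 (fun s => ‖f s‖ₑ ^ 2), mul_add]
  exact add_le_add h1 h2

end Volterra

section OscillatoryIntegral

lemma norm_integral_div_sub_le_of_im_pos {φ : ℝ → ℂ} (hφ : Integrable φ) {M : ℝ}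
    (hM : ∀ ξ, (1 + ξ ^ 2) * ‖𝓕 φ ξ‖ ≤ M) (y : ℝ) {z : ℂ} (hz : 0 < z.im) :
    ‖∫ x : ℝ, φ x * cexp (2 * Real.pi * I * y * x) / (x - z)‖ ≤ 2 * Real.pi ^ 2 * M := by
  have hne : ∀ x : ℝ, (x : ℂ) - z ≠ 0 := fun x h => by
    have := congrArg Complex.im h
    simp at this
    exact hz.ne' this
  have hrep : ∀ x : ℝ, 1 / ((x : ℂ) - z)
      = ∫ s in Set.Ioi (0 : ℝ), 2 * Real.pi * I * cexp (-(2 * Real.pi * I * (x - z)) * s) := by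
    intro x
    rw [integral_const_mul, integral_exp_mul_complex_Ioi]
    · have := hne x
      have hpi : (Real.pi : ℂ) ≠ 0 := by exact_mod_cast Real.pi_ne_zero
      simp
      field_simp
      rw [I_sq, neg_neg]
    · simp
      positivity
  have hint : Integrable (fun p : ℝ × ℝ => φ p.1 * cexp (2 * Real.pi * I * y * p.1) *
      (2 * Real.pi * I * cexp (-(2 * Real.pi * I * (p.1 - z)) * p.2)))
      (volume.prod (volume.restrict (Set.Ioi (0 : ℝ)))) := by
    have h1 : Integrable (fun p : ℝ × ℝ => φ p.1 * ((2 * Real.pi * Real.exp (-(2 * Real.pi * z.im) * p.2) : ℝ) : ℂ))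
        (volume.prod (volume.restrict (Set.Ioi (0 : ℝ)))) :=
      hφ.mul_prod (ν := volume.restrict (Set.Ioi (0 : ℝ)))
        (g := fun s => ((2 * Real.pi * Real.exp (-(2 * Real.pi * z.im) * s) : ℝ) : ℂ))
        (((exp_neg_integrableOn_Ioi 0 (by positivity : 0 < 2 * Real.pi * z.im)).const_mul (2 * Real.pi)).ofReal)
    refine h1.mono ?_ (.of_forall fun p => ?_)
    · refine AEStronglyMeasurable.mul (AEStronglyMeasurable.mul (hφ.1.comp_fst) ?_) ?_ <;>
      exact Continuous.aestronglyMeasurable (by fun_prop)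
    · simp only [norm_mul, Complex.norm_exp, Complex.norm_real]
      apply le_of_eq
      simp [abs_of_pos Real.pi_pos]
  have hfour : ∀ s : ℝ, ∫ x : ℝ, φ x * cexp (2 * Real.pi * I * y * x) *
      (2 * Real.pi * I * cexp (-(2 * Real.pi * I * (x - z)) * s))
      = 2 * Real.pi * I * cexp (2 * Real.pi * I * z * s) * 𝓕 φ (s - y) := by
    intro s
    rw [Real.fourier_real_eq_integral_exp_smul, ← integral_const_mul]
    refine integral_congr_ae (.of_forall fun x => ?_)
    simp only [smul_eq_mul]
    have : cexp (2 * Real.pi * I * y * x) * cexp (-(2 * Real.pi * I * (x - z)) * s)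
      = cexp (2 * Real.pi * I * z * s) * cexp (((-2 * Real.pi * x * (s - y) : ℝ) : ℂ) * I) := by
      rw [← Complex.exp_add, ← Complex.exp_add]; push_cast; ring_nf
    linear_combination (2 * Real.pi * I * φ x) * this
  have hM0 : 0 ≤ M := le_trans (by positivity) (hM 0)
  have hint2 : Integrable fun s : ℝ => 2 * Real.pi * M * (1 + (s - y) ^ 2)⁻¹ :=
    (integrable_inv_one_add_sq.comp_sub_right y).const_mul _
  calc ‖∫ x : ℝ, φ x * cexp (2 * Real.pi * I * y * x) / (x - z)‖
      = ‖∫ x : ℝ, ∫ s in Set.Ioi (0 : ℝ), φ x * cexp (2 * Real.pi * I * y * x) *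
        (2 * Real.pi * I * cexp (-(2 * Real.pi * I * (x - z)) * s))‖ := by
        congr 1
        refine integral_congr_ae (.of_forall fun x => ?_)
        dsimp only
        rw [integral_const_mul, ← hrep, mul_one_div]
    _ = ‖∫ s in Set.Ioi (0 : ℝ), 2 * Real.pi * I * cexp (2 * Real.pi * I * z * s) * 𝓕 φ (s - y)‖ := by
        rw [integral_integral_swap hint]
        simp_rw [hfour]
    _ ≤ ∫ s in Set.Ioi (0 : ℝ), 2 * Real.pi * M * (1 + (s - y) ^ 2)⁻¹ := by
        refine norm_integral_le_of_norm_le hint2.integrableOn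
          ((ae_restrict_mem measurableSet_Ioi).mono fun s hs => ?_)
        have hs : (0 : ℝ) < s := hs
        have h1 : ‖cexp (2 * Real.pi * I * z * s)‖ ≤ 1 := by
          rw [Complex.norm_exp, Real.exp_le_one_iff]
          simp
          positivity
        have h2 : ‖𝓕 φ (s - y)‖ ≤ M * (1 + (s - y) ^ 2)⁻¹ := by
          rw [← div_eq_mul_inv, le_div_iff₀ (by positivity), mul_comm]
          exact hM _
        have h3 : ‖(2 * Real.pi * I : ℂ)‖ = 2 * Real.pi := by simp [abs_of_pos Real.pi_pos]
        rw [norm_mul, norm_mul, h3, mul_assoc, mul_assoc (2 * Real.pi)]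
        refine mul_le_mul_of_nonneg_left ?_ (by positivity)
        exact (mul_le_of_le_one_left (norm_nonneg _) h1).trans h2
    _ ≤ ∫ s : ℝ, 2 * Real.pi * M * (1 + (s - y) ^ 2)⁻¹ :=
        setIntegral_le_integral hint2 (.of_forall fun s => by positivity)
    _ = 2 * Real.pi ^ 2 * M := by
        rw [integral_const_mul, integral_sub_right_eq_self (fun s : ℝ => (1 + s ^ 2)⁻¹) y,
          integral_univ_inv_one_add_sq]
        ring

lemma norm_integral_div_sub_le {φ : ℝ → ℂ} (hφ : Integrable φ) {M : ℝ}
    (hM : ∀ ξ, (1 + ξ ^ 2) * ‖𝓕 φ ξ‖ ≤ M) (y : ℝ) {z : ℂ} (hz : z.im ≠ 0) :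
    ‖∫ x : ℝ, φ x * cexp (2 * Real.pi * I * y * x) / (x - z)‖ ≤ 2 * Real.pi ^ 2 * M := by
  rcases hz.lt_or_gt with h | h
  · have hneg : ∀ ξ, 𝓕 (fun x => φ (-x)) ξ = 𝓕 φ (-ξ) := fun ξ => by
      rw [← Real.fourierInv_eq_fourier_neg, Real.fourierInv_eq_fourier_comp_neg]
    have := norm_integral_div_sub_le_of_im_pos (φ := fun x => φ (-x)) hφ.comp_neg
      (M := M) (fun ξ => by rw [hneg]; simpa using hM (-ξ)) (-y) (z := -z) (by simpa using h)
    refine le_trans (le_of_eq ?_) this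
    rw [← integral_neg_eq_self, ← norm_neg, ← integral_neg]
    congr 2
    ext x
    push_cast
    rw [← div_neg]
    congr 2
    · ring_nf
    · ring
  · exact norm_integral_div_sub_le_of_im_pos hφ hM y h

/-- A `C²` function supported in a bounded interval has quadratically decaying Fourier transform. -/
lemma one_add_sq_mul_norm_fourier_le {φ φ₁ φ₂ : ℝ → ℂ} (h0 : ∀ x, HasDerivAt φ (φ₁ x) x)
    (h1 : ∀ x, HasDerivAt φ₁ (φ₂ x) x) {R B : ℝ} (hR : 0 ≤ R) (hs0 : ∀ x, R < |x| → φ x = 0)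
    (hs1 : ∀ x, R < |x| → φ₁ x = 0) (hs2 : ∀ x, R < |x| → φ₂ x = 0) (hb0 : ∀ x, ‖φ x‖ ≤ B)
    (hb1 : ∀ x, ‖φ₁ x‖ ≤ B) (hb2 : ∀ x, ‖φ₂ x‖ ≤ B) :
    Integrable φ ∧ ∀ ξ, (1 + ξ ^ 2) * ‖𝓕 φ ξ‖ ≤ 4 * R * B := by
  have key : ∀ f : ℝ → ℂ, AEStronglyMeasurable f → (∀ x, R < |x| → f x = 0) → (∀ x, ‖f x‖ ≤ B) →
      Integrable f ∧ ∫ x, ‖f x‖ ≤ 2 * R * B := by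
    intro f hm hs hb
    have hle : ∀ x, ‖f x‖ ≤ (Set.Icc (-R) R).indicator (fun _ => B) x := by
      intro x
      by_cases hx : x ∈ Set.Icc (-R) R
      · rw [Set.indicator_of_mem hx]; exact hb x
      · rw [Set.indicator_of_notMem hx, hs x, norm_zero]
        rw [Set.mem_Icc, ← abs_le] at hx
        exact not_le.1 hx
    have hi : Integrable ((Set.Icc (-R) R).indicator fun _ => B) :=
      (integrable_indicator_iff measurableSet_Icc).2 (integrableOn_const (by simp))
    have hf : Integrable f := hi.mono' hm (.of_forall hle)
    refine ⟨hf, (integral_mono hf.norm hi hle).trans (le_of_eq ?_)⟩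
    rw [integral_indicator measurableSet_Icc]
    simp [hR]
    left; ring
  have d0 : deriv φ = φ₁ := funext fun x => (h0 x).deriv
  have d1 : deriv φ₁ = φ₂ := funext fun x => (h1 x).deriv
  have c0 : Differentiable ℝ φ := fun x => (h0 x).differentiableAt
  have c1 : Differentiable ℝ φ₁ := fun x => (h1 x).differentiableAt
  obtain ⟨i0, n0⟩ := key φ c0.continuous.aestronglyMeasurable hs0 hb0
  obtain ⟨i1, -⟩ := key φ₁ c1.continuous.aestronglyMeasurable hs1 hb1
  obtain ⟨i2, n2⟩ := key φ₂ (by rw [← d1]; exact (stronglyMeasurable_deriv _).aestronglyMeasurable) hs2 hb2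
  refine ⟨i0, fun ξ => ?_⟩
  have f1 := congrFun (Real.fourier_deriv i0 c0 (by rwa [d0])) ξ
  have f2 := congrFun (Real.fourier_deriv i1 c1 (by rwa [d1])) ξ
  rw [d0] at f1
  rw [d1, f1, smul_smul] at f2
  have n : ‖𝓕 φ₂ ξ‖ = (2 * Real.pi) ^ 2 * ξ ^ 2 * ‖𝓕 φ ξ‖ := by
    rw [f2, norm_smul]
    simp [abs_of_pos Real.pi_pos]
    left
    rw [← sq_abs ξ]; ring
  have b0 : ‖𝓕 φ ξ‖ ≤ 2 * R * B :=
    (VectorFourier.norm_fourierIntegral_le_integral_norm _ _ _ _ _).trans n0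
  have b2 : ‖𝓕 φ₂ ξ‖ ≤ 2 * R * B :=
    (VectorFourier.norm_fourierIntegral_le_integral_norm _ _ _ _ _).trans n2
  rw [n] at b2
  have hpi : 1 ≤ (2 * Real.pi) ^ 2 := by nlinarith [Real.pi_gt_three]
  have : ξ ^ 2 * ‖𝓕 φ ξ‖ ≤ (2 * Real.pi) ^ 2 * ξ ^ 2 * ‖𝓕 φ ξ‖ := by
    rw [mul_assoc]
    exact le_mul_of_one_le_left (by positivity) hpi
  linarith

lemma DNLS.IsBump.contDiff_deriv {χ : ℝ → ℝ} (hχ : IsBump χ) : ContDiff ℝ 1 (deriv χ) :=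
  (contDiff_succ_iff_deriv (n := 1)).1
    (one_add_one_eq_two (R := WithTop ℕ∞) ▸ hχ.smooth 2) |>.2.2

lemma DNLS.IsBump.exists_bounds {χ : ℝ → ℝ} (hχ : IsBump χ) : ∃ B : ℝ, 1 ≤ B ∧ (∀ s, |χ s| ≤ B) ∧
    (∀ s, |1 - χ s| ≤ B) ∧ (∀ s, |deriv χ s| ≤ B) ∧ (∀ s, |deriv (deriv χ) s| ≤ B) := by
  have hc : HasCompactSupport χ :=
    HasCompactSupport.intro (isCompact_Icc (a := -2) (b := 2)) fun s hs => hχ.supp s (by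
      rw [Set.mem_Icc, ← abs_le] at hs
      exact (not_le.1 hs).le)
  have h1 := hχ.contDiff_deriv
  obtain ⟨B₀, h₀⟩ := hc.exists_bound_of_continuous (hχ.smooth 0).continuous
  obtain ⟨B₁, h₁⟩ := hc.deriv.exists_bound_of_continuous h1.continuous
  obtain ⟨B₂, h₂⟩ := hc.deriv.deriv.exists_bound_of_continuous (h1.continuous_deriv le_rfl)
  simp only [Real.norm_eq_abs] at h₀ h₁ h₂
  have p₀ := (abs_nonneg _).trans (h₀ 0)
  have p₁ := (abs_nonneg _).trans (h₁ 0)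
  have p₂ := (abs_nonneg _).trans (h₂ 0)
  refine ⟨1 + B₀ + B₁ + B₂, by linarith, fun s => ?_, fun s => ?_, fun s => ?_, fun s => ?_⟩
  · linarith [h₀ s]
  · have := abs_sub (1 : ℝ) (χ s)
    rw [abs_one] at this
    linarith [h₀ s]
  · linarith [h₁ s]
  · linarith [h₂ s]

lemma DNLS.IsBump.hasDerivAt {χ : ℝ → ℝ} (hχ : IsBump χ) (s : ℝ) : HasDerivAt χ (deriv χ s) s :=
  ((hχ.smooth 1).differentiable (by norm_num) s).hasDerivAt

lemma DNLS.IsBump.hasDerivAt_deriv {χ : ℝ → ℝ} (hχ : IsBump χ) (s : ℝ) :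
    HasDerivAt (deriv χ) (deriv (deriv χ) s) s := by
  have h1 := hχ.contDiff_deriv
  exact (h1.differentiable (by norm_num) s).hasDerivAt

lemma DNLS.IsBump.deriv_eq_zero_of_lt_one {χ : ℝ → ℝ} (hχ : IsBump χ) {s : ℝ} (hs : |s| < 1) :
    deriv χ s = 0 := by
  have : χ =ᶠ[𝓝 s] fun _ => 1 := by
    filter_upwards [(isOpen_lt continuous_abs continuous_const).mem_nhds hs] with x hx
    exact hχ.one x (le_of_lt hx)
  rw [this.deriv_eq, deriv_const]

lemma DNLS.IsBump.deriv_deriv_eq_zero_of_lt_one {χ : ℝ → ℝ} (hχ : IsBump χ) {s : ℝ} (hs : |s| < 1) :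
    deriv (deriv χ) s = 0 := by
  have : deriv χ =ᶠ[𝓝 s] fun _ => 0 := by
    filter_upwards [(isOpen_lt continuous_abs continuous_const).mem_nhds hs] with x hx
    exact hχ.deriv_eq_zero_of_lt_one hx
  rw [this.deriv_eq, deriv_const]

lemma DNLS.IsBump.eq_zero_of_two_lt {χ : ℝ → ℝ} (hχ : IsBump χ) {s : ℝ} (hs : 2 < |s|) :
    χ s = 0 ∧ deriv χ s = 0 ∧ deriv (deriv χ) s = 0 := by
  have h0 : ∀ s, 2 < |s| → χ =ᶠ[𝓝 s] fun _ => 0 := fun s hs => by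
    filter_upwards [(isOpen_lt continuous_const continuous_abs).mem_nhds hs] with x hx
    exact hχ.supp x (le_of_lt hx)
  have h1 : ∀ s, 2 < |s| → deriv χ s = 0 := fun s hs => by rw [(h0 s hs).deriv_eq, deriv_const]
  have h2 : deriv χ =ᶠ[𝓝 s] fun _ => 0 := by
    filter_upwards [(isOpen_lt continuous_const continuous_abs).mem_nhds hs] with x hx
    exact h1 x hx
  exact ⟨hχ.supp s hs.le, h1 s hs, by rw [h2.deriv_eq, deriv_const]⟩

/-- The smooth cutoff `1 - χ (N s)` restricted to the half-line `s > 0`. -/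
def halfCutoff (χ : ℝ → ℝ) (N s : ℝ) : ℝ := if 0 < s then 1 - χ (N * s) else 0

lemma DNLS.IsBump.halfCutoff_add {χ : ℝ → ℝ} (hχ : IsBump χ) (N s : ℝ) :
    halfCutoff χ N s + halfCutoff χ N (-s) = 1 - χ (N * s) := by
  rcases lt_trichotomy s 0 with h | h | h
  · simp [halfCutoff, h, h.le, hχ.even]
  · simp [halfCutoff, h, hχ.one]
  · simp [halfCutoff, h, h.le]

lemma DNLS.IsBump.exists_quotient_bounds {χ : ℝ → ℝ} (hχ : IsBump χ) {N : ℝ} (hN : 1 ≤ N) :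
    ∃ B : ℝ, 0 ≤ B ∧ ∀ w : ℂ, 0 ≤ w.re → ∃ h₁ h₂ : ℝ → ℂ,
      (∀ s, HasDerivAt (fun s : ℝ => (halfCutoff χ N s : ℂ) / (s + w)) (h₁ s) s) ∧
      (∀ s, HasDerivAt h₁ (h₂ s) s) ∧ (∀ s, ‖(halfCutoff χ N s : ℂ) / (s + w)‖ ≤ B) ∧
      (∀ s, ‖h₁ s‖ ≤ B) ∧ (∀ s, ‖h₂ s‖ ≤ B) := by
  obtain ⟨B, hB1, -, hb0, hb1, hb2⟩ := hχ.exists_bounds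
  have hN0 : 0 < N := by linarith
  refine ⟨5 * B * N ^ 3, by positivity, fun w hw => ?_⟩
  let D : ℝ → ℂ := fun s => (s + w)⁻¹
  let H₁ : ℝ → ℂ := fun s => -N * deriv χ (N * s) * D s - (1 - χ (N * s)) * D s ^ 2
  let H₂ : ℝ → ℂ := fun s => -N ^ 2 * deriv (deriv χ) (N * s) * D s + 2 * N * deriv χ (N * s) * D s ^ 2
    + 2 * (1 - χ (N * s)) * D s ^ 3
  have hne : ∀ s : ℝ, 0 < s → (s : ℂ) + w ≠ 0 := fun s hs h => by
    have := congrArg Complex.re h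
    simp at this
    linarith
  have hχN : ∀ s : ℝ, HasDerivAt (fun s : ℝ => ((χ (N * s) : ℝ) : ℂ))
      (N * deriv χ (N * s)) s := fun s => by
    have := ((hχ.hasDerivAt (N * s)).comp s ((hasDerivAt_id s).const_mul N)).ofReal_comp
    refine HasDerivAt.congr_deriv this ?_
    push_cast; ring
  have hχ'N : ∀ s : ℝ, HasDerivAt (fun s : ℝ => ((deriv χ (N * s) : ℝ) : ℂ))
      (N * deriv (deriv χ) (N * s)) s := fun s => by
    have := ((hχ.hasDerivAt_deriv (N * s)).comp s ((hasDerivAt_id s).const_mul N)).ofReal_comp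
    refine HasDerivAt.congr_deriv this ?_
    push_cast; ring
  have hD : ∀ s : ℝ, 0 < s → HasDerivAt D (-D s ^ 2) s := fun s hs => by
    have := ((hasDerivAt_id s).ofReal_comp.add_const w).inv (hne s hs)
    refine HasDerivAt.congr_deriv this ?_
    have := hne s hs
    simp [D, div_eq_mul_inv]
  have hsmall : ∀ s : ℝ, 0 < s → s < N⁻¹ → |N * s| < 1 := fun s hs h => by
    rw [abs_of_pos (by positivity)]
    rwa [lt_inv_comm₀ hs hN0, inv_eq_one_div, lt_div_iff₀ hs] at h
  have hDb : ∀ s : ℝ, N⁻¹ ≤ s → ‖D s‖ ≤ N := fun s hs => by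
    have h1 : N⁻¹ ≤ ‖(s : ℂ) + w‖ := by
      refine le_trans ?_ (Complex.re_le_norm _)
      simp
      linarith
    simp only [D, norm_inv]
    exact inv_le_of_inv_le₀ hN0 h1
  -- transfer from the formulas on `s > 0` to their extensions by zero
  have ext_deriv : ∀ (f f' : ℝ → ℂ), (∀ s, 0 < s → s < N⁻¹ → f s = 0) →
      (∀ s, 0 < s → HasDerivAt f (f' s) s) → ∀ s : ℝ,
      HasDerivAt (fun s => if 0 < s then f s else 0) (if 0 < s then f' s else 0) s := by
    intro f f' hf hd s
    by_cases hs : 0 < s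
    · rw [if_pos hs]
      refine (hd s hs).congr_of_eventuallyEq ?_
      filter_upwards [lt_mem_nhds hs] with x hx
      rw [if_pos hx]
    · rw [if_neg hs]
      refine (hasDerivAt_const s (0 : ℂ)).congr_of_eventuallyEq ?_
      have : s < N⁻¹ := (not_lt.1 hs).trans_lt (by positivity)
      filter_upwards [gt_mem_nhds this] with x hx
      by_cases hx0 : 0 < x
      · rw [if_pos hx0]; exact hf x hx0 hx
      · rw [if_neg hx0]
  have ext_bound : ∀ (f : ℝ → ℂ), (∀ s, 0 < s → s < N⁻¹ → f s = 0) →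
      (∀ s, N⁻¹ ≤ s → ‖f s‖ ≤ 5 * B * N ^ 3) → ∀ s : ℝ, ‖if 0 < s then f s else 0‖ ≤ 5 * B * N ^ 3 := by
    intro f hf hb s
    by_cases hs : 0 < s
    · rw [if_pos hs]
      rcases lt_or_ge s N⁻¹ with h | h
      · rw [hf s hs h, norm_zero]; positivity
      · exact hb s h
    · rw [if_neg hs, norm_zero]; positivity
  have e0 : (fun s : ℝ => (halfCutoff χ N s : ℂ) / (s + w))
      = fun s => if 0 < s then (1 - χ (N * s)) * D s else 0 := by
    ext s
    by_cases hs : 0 < s <;> simp [halfCutoff, hs, D, div_eq_mul_inv]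
  have z0 : ∀ s, 0 < s → s < N⁻¹ → (1 - χ (N * s)) * D s = 0 := fun s hs h => by
    rw [hχ.one _ (hsmall s hs h).le]; simp
  have z1 : ∀ s, 0 < s → s < N⁻¹ → H₁ s = 0 := fun s hs h => by
    simp [H₁, hχ.one _ (hsmall s hs h).le, hχ.deriv_eq_zero_of_lt_one (hsmall s hs h)]
  have z2 : ∀ s, 0 < s → s < N⁻¹ → H₂ s = 0 := fun s hs h => by
    simp [H₂, hχ.one _ (hsmall s hs h).le, hχ.deriv_eq_zero_of_lt_one (hsmall s hs h),
      hχ.deriv_deriv_eq_zero_of_lt_one (hsmall s hs h)]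
  have n0 : ∀ s, ‖(1 - χ (N * s) : ℂ)‖ ≤ B := fun s => by
    have := hb0 (N * s)
    rw [← Real.norm_eq_abs, ← Complex.norm_real] at this
    simpa using this
  have n1 : ∀ s, ‖((deriv χ (N * s) : ℝ) : ℂ)‖ ≤ B := fun s => by
    rw [Complex.norm_real]; exact hb1 _
  have n2 : ∀ s, ‖((deriv (deriv χ) (N * s) : ℝ) : ℂ)‖ ≤ B := fun s => by
    rw [Complex.norm_real]; exact hb2 _
  have nN : ‖(N : ℂ)‖ = N := by rw [Complex.norm_real, Real.norm_of_nonneg hN0.le]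
  have hN13 : N ≤ N ^ 3 := le_self_pow₀ hN (by norm_num)
  have hN23 : N ^ 2 ≤ N ^ 3 := pow_le_pow_right₀ hN (by norm_num)
  refine ⟨fun s => if 0 < s then H₁ s else 0, fun s => if 0 < s then H₂ s else 0, ?_, ?_, ?_, ?_, ?_⟩
  · rw [e0]
    refine ext_deriv _ H₁ z0 fun s hs => ?_
    refine (((hχN s).const_sub 1).mul (hD s hs)).congr_deriv ?_
    simp only [H₁]; ring
  · refine ext_deriv _ H₂ z1 fun s hs => ?_
    refine ((((hχ'N s).const_mul (-N : ℂ)).mul (hD s hs)).sub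
      (((hχN s).const_sub 1).mul ((hD s hs).pow 2))).congr_deriv ?_
    simp only [H₂, Pi.pow_apply]; push_cast; ring
  · intro s
    rw [congrFun e0 s]
    refine ext_bound _ z0 (fun s hs => ?_) s
    rw [norm_mul]
    calc _ ≤ B * N := by gcongr; exacts [n0 s, hDb s hs]
      _ ≤ B * N ^ 3 := by gcongr
      _ ≤ _ := by nlinarith [pow_pos hN0 3]
  · refine ext_bound _ z1 fun s hs => ?_
    calc ‖H₁ s‖ ≤ ‖-N * deriv χ (N * s) * D s‖ + ‖(1 - χ (N * s)) * D s ^ 2‖ := norm_sub_le _ _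
      _ ≤ N * B * N + B * N ^ 2 := by
        simp only [norm_mul, norm_neg, norm_pow, nN]
        gcongr
        exacts [n1 s, hDb s hs, n0 s, hDb s hs]
      _ ≤ _ := by nlinarith [pow_pos hN0 3]
  · refine ext_bound _ z2 fun s hs => ?_
    calc ‖H₂ s‖ ≤ ‖-N ^ 2 * deriv (deriv χ) (N * s) * D s‖ + ‖2 * N * deriv χ (N * s) * D s ^ 2‖
          + ‖2 * (1 - χ (N * s)) * D s ^ 3‖ := norm_add₃_le
      _ ≤ N ^ 2 * B * N + 2 * N * B * N ^ 2 + 2 * B * N ^ 3 := by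
        simp only [norm_mul, norm_neg, norm_pow, nN, Complex.norm_ofNat]
        gcongr
        exacts [n2 s, hDb s hs, n1 s, hDb s hs, n0 s, hDb s hs]
      _ = _ := by ring

lemma exists_root_re_nonneg {a b c δ : ℝ} (hδ : δ ≠ 0) (h : a ≠ 0 ∨ 0 < b) :
    ∃ z w : ℂ, z.im ≠ 0 ∧ 0 ≤ w.re ∧
      ∀ x : ℝ, (δ : ℂ) + I * (a * x ^ 2 + 2 * b * x + c : ℝ) = I * (x - z) * ((a * x + b : ℝ) + w) := by
  suffices ∃ z w : ℂ, 0 ≤ w.re ∧ w = a * z + b ∧ a * z ^ 2 + 2 * b * z + c = I * δ by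
    obtain ⟨z, w, hw, hwz, hz⟩ := this
    refine ⟨z, w, fun him => ?_, hw, fun x => ?_⟩
    · have hzr : z = (z.re : ℂ) := Complex.ext rfl (by simpa using him)
      rw [hzr] at hz
      have := congrArg Complex.im hz
      norm_cast at this
      simp at this
      exact hδ this.symm
    · rw [hwz]
      push_cast
      linear_combination I * hz + δ * I_sq
  by_cases ha : a = 0
  · have hb : 0 < b := h.resolve_left (not_not.2 ha)
    refine ⟨(I * δ - c) / (2 * b), b, by simpa using hb.le, by simp [ha], ?_⟩
    have : (b : ℂ) ≠ 0 := by exact_mod_cast hb.ne'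
    rw [ha]
    field_simp
    push_cast
    ring
  · obtain ⟨w, hw, hw2⟩ : ∃ w : ℂ, 0 ≤ w.re ∧ w ^ 2 = b ^ 2 - a * c + I * a * δ := by
      obtain ⟨w, hw⟩ := IsAlgClosed.exists_pow_nat_eq ((b : ℂ) ^ 2 - a * c + I * a * δ) (n := 2) (by norm_num)
      rcases le_total 0 w.re with h | h
      · exact ⟨w, h, hw⟩
      · exact ⟨-w, by simpa using h, by simpa using hw⟩
    have ha' : (a : ℂ) ≠ 0 := by exact_mod_cast ha
    refine ⟨(w - b) / a, w, hw, by field_simp; ring, ?_⟩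
    field_simp
    linear_combination hw2


/-- The symbol obtained by inserting the half-line cutoff in the resolvent of a quadratic. -/
lemma DNLS.IsBump.exists_half_resolvent_bound {χ : ℝ → ℝ} (hχ : IsBump χ) {N : ℝ} (hN : 1 ≤ N) :
    ∃ C : ℝ, 0 ≤ C ∧ ∀ a b c y δ : ℝ, |a| ≤ 1 → δ ≠ 0 →
      Integrable (fun x : ℝ => (χ (x / 2) * halfCutoff χ N (a * x + b) : ℝ) *
        cexp (2 * Real.pi * I * y * x) / (δ + I * (a * x ^ 2 + 2 * b * x + c : ℝ))) ∧
      ‖∫ x : ℝ, (χ (x / 2) * halfCutoff χ N (a * x + b) : ℝ) *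
        cexp (2 * Real.pi * I * y * x) / (δ + I * (a * x ^ 2 + 2 * b * x + c : ℝ))‖ ≤ C := by
  obtain ⟨B, hB0, hB⟩ := hχ.exists_quotient_bounds hN
  obtain ⟨B', hB1, hc0, -, hc1, hc2⟩ := hχ.exists_bounds
  refine ⟨2 * Real.pi ^ 2 * (4 * 4 * (4 * B' * B)), by positivity, fun a b c y δ ha hδ => ?_⟩
  by_cases hab : a ≠ 0 ∨ 0 < b
  swap
  · push Not at hab
    have : ∀ x : ℝ, halfCutoff χ N (a * x + b) = 0 := fun x => by
      rw [hab.1, zero_mul, zero_add, halfCutoff, if_neg hab.2.not_gt]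
    simp [this]
    positivity
  obtain ⟨z, w, hz, hw, hzw⟩ := exists_root_re_nonneg (c := c) hδ hab
  obtain ⟨h₁, h₂, hd0, hd1, b0, b1, b2⟩ := hB w hw
  set h₀ : ℝ → ℂ := fun s : ℝ => (halfCutoff χ N s : ℂ) / (s + w) with hh₀
  have haff : ∀ x : ℝ, HasDerivAt (fun x : ℝ => a * x + b) a x := fun x => by
    simpa using ((hasDerivAt_id x).const_mul a).add_const b
  have hhalf : ∀ x : ℝ, HasDerivAt (fun x : ℝ => x / 2) (1 / 2) x := fun x =>
    (hasDerivAt_id x).div_const 2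
  have ck : ∀ (f : ℝ → ℝ) (f' : ℝ → ℝ), (∀ s, HasDerivAt f (f' s) s) → ∀ x : ℝ,
      HasDerivAt (fun x : ℝ => ((f (x / 2) : ℝ) : ℂ)) (1 / 2 * f' (x / 2)) x := by
    intro f f' hf x
    refine HasDerivAt.congr_deriv ((hf (x / 2)).comp x (hhalf x)).ofReal_comp ?_
    push_cast; ring
  have hk : ∀ (f f' : ℝ → ℂ), (∀ s, HasDerivAt f (f' s) s) → ∀ x : ℝ,
      HasDerivAt (fun x : ℝ => f (a * x + b)) (a * f' (a * x + b)) x := by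
    intro f f' hf x
    refine HasDerivAt.congr_deriv ((hf (a * x + b)).scomp x (haff x)) ?_
    rw [Complex.real_smul]
  let φ : ℝ → ℂ := fun x => (χ (x / 2) : ℝ) * h₀ (a * x + b)
  let φ₁ : ℝ → ℂ := fun x => 1 / 2 * (deriv χ (x / 2) : ℝ) * h₀ (a * x + b)
    + (χ (x / 2) : ℝ) * (a * h₁ (a * x + b))
  let φ₂ : ℝ → ℂ := fun x => 1 / 4 * (deriv (deriv χ) (x / 2) : ℝ) * h₀ (a * x + b)
    + (deriv χ (x / 2) : ℝ) * (a * h₁ (a * x + b)) + (χ (x / 2) : ℝ) * (a ^ 2 * h₂ (a * x + b))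
  have nχ : ∀ x, ‖((χ x : ℝ) : ℂ)‖ ≤ B' := fun x => by rw [Complex.norm_real]; exact hc0 x
  have nχ1 : ∀ x, ‖((deriv χ x : ℝ) : ℂ)‖ ≤ B' := fun x => by rw [Complex.norm_real]; exact hc1 x
  have nχ2 : ∀ x, ‖((deriv (deriv χ) x : ℝ) : ℂ)‖ ≤ B' := fun x => by
    rw [Complex.norm_real]; exact hc2 x
  have na : ‖(a : ℂ)‖ ≤ 1 := by rwa [Complex.norm_real]
  have hsupp : ∀ x : ℝ, 4 < |x| → 2 < |x / 2| := fun x hx => by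
    rw [abs_div, abs_two]; linarith
  obtain ⟨hφi, hφ⟩ := one_add_sq_mul_norm_fourier_le (φ := φ) (φ₁ := φ₁) (φ₂ := φ₂) (R := 4)
    (B := 4 * B' * B)
    (fun x => ((ck χ _ hχ.hasDerivAt x).mul (hk _ _ hd0 x)).congr_deriv (by simp only [φ₁]))
    (fun x => ((((ck _ _ hχ.hasDerivAt_deriv x).const_mul (1 / 2 : ℂ)).mul (hk _ _ hd0 x)).add
      ((ck χ _ hχ.hasDerivAt x).mul ((hk _ _ hd1 x).const_mul (a : ℂ)))).congr_deriv
        (by simp only [φ₂]; ring))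
    (by norm_num)
    (fun x hx => by simp [φ, hχ.eq_zero_of_two_lt (hsupp x hx)])
    (fun x hx => by simp [φ₁, hχ.eq_zero_of_two_lt (hsupp x hx)])
    (fun x hx => by simp [φ₂, hχ.eq_zero_of_two_lt (hsupp x hx)])
    (fun x => by
      simp only [φ, norm_mul]
      calc _ ≤ B' * B := by gcongr; exacts [nχ _, b0 _]
        _ ≤ 4 * B' * B := by nlinarith [mul_nonneg (zero_le_one.trans hB1) hB0])
    (fun x => by
      refine (norm_add_le _ _).trans ?_
      simp only [norm_mul]
      calc _ ≤ ‖(1 / 2 : ℂ)‖ * B' * B + B' * (1 * B) := by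
            gcongr; exacts [nχ1 _, b0 _, nχ _, b1 _]
        _ ≤ 4 * B' * B := by norm_num; nlinarith [mul_nonneg (zero_le_one.trans hB1) hB0])
    (fun x => by
      refine norm_add₃_le.trans ?_
      simp only [norm_mul, norm_pow]
      calc _ ≤ ‖(1 / 4 : ℂ)‖ * B' * B + B' * (1 * B) + B' * (1 ^ 2 * B) := by
            gcongr; exacts [nχ2 _, b0 _, nχ1 _, b1 _, nχ _, b2 _]
        _ ≤ 4 * B' * B := by norm_num; nlinarith [mul_nonneg (zero_le_one.trans hB1) hB0])
  have heq : ∀ x : ℝ, ((χ (x / 2) * halfCutoff χ N (a * x + b) : ℝ) : ℂ) *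
        cexp (2 * Real.pi * I * y * x) / (δ + I * (a * x ^ 2 + 2 * b * x + c : ℝ))
      = -I * (φ x * cexp (2 * Real.pi * I * y * x) / (x - z)) := fun x => by
    rw [hzw]
    simp only [φ, hh₀]
    push_cast
    have : -I = I⁻¹ := by simp
    rw [this]
    simp only [div_eq_mul_inv, mul_inv]
    ring
  have hne : ∀ x : ℝ, |z.im| ≤ ‖(x : ℂ) - z‖ := fun x => by
    simpa using Complex.abs_im_le_norm ((x : ℂ) - z)
  have hne0 : ∀ x : ℝ, (x : ℂ) - z ≠ 0 := fun x => by
    rw [← norm_pos_iff]; exact (abs_pos.2 hz).trans_le (hne x)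
  simp_rw [heq]
  refine ⟨Integrable.const_mul ?_ _, ?_⟩
  · refine ((hφi.norm.mul_const |z.im|⁻¹).mono' ?_ (.of_forall fun x => ?_))
    · refine AEStronglyMeasurable.mul (hφi.1.mul (by fun_prop)) ?_
      exact (Continuous.inv₀ (by fun_prop) hne0).aestronglyMeasurable
    · rw [norm_div, norm_mul, div_eq_mul_inv]
      have : ‖cexp (2 * Real.pi * I * y * x)‖ = 1 := by
        rw [Complex.norm_exp]; simp
      rw [this, mul_one]
      gcongr
      exact hne x
  · rw [integral_const_mul, norm_mul, norm_neg, norm_I, one_mul]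
    exact norm_integral_div_sub_le hφi hφ y hz

/-- Uniform bound for the kernel of the resolvent of a quadratic, localised away from its
critical point. -/
lemma DNLS.IsBump.exists_resolvent_bound {χ : ℝ → ℝ} (hχ : IsBump χ) {N : ℝ} (hN : 1 ≤ N) :
    ∃ C : ℝ, 0 ≤ C ∧ ∀ a b c y δ : ℝ, |a| ≤ 1 → δ ≠ 0 →
      ‖∫ x : ℝ, (χ (x / 2) * (1 - χ (N * (a * x + b))) : ℝ) *
        cexp (2 * Real.pi * I * y * x) / (δ + I * (a * x ^ 2 + 2 * b * x + c : ℝ))‖ ≤ C := by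
  obtain ⟨C, hC0, hC⟩ := hχ.exists_half_resolvent_bound hN
  refine ⟨C + C, by positivity, fun a b c y δ ha hδ => ?_⟩
  obtain ⟨i1, n1⟩ := hC a b c y δ ha hδ
  obtain ⟨i2, n2⟩ := hC (-a) (-b) (-c) y (-δ) (by rwa [abs_neg]) (neg_ne_zero.2 hδ)
  have : ∀ x : ℝ, ((χ (x / 2) * (1 - χ (N * (a * x + b))) : ℝ) : ℂ) *
        cexp (2 * Real.pi * I * y * x) / (δ + I * (a * x ^ 2 + 2 * b * x + c : ℝ))
      = (χ (x / 2) * halfCutoff χ N (a * x + b) : ℝ) *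
        cexp (2 * Real.pi * I * y * x) / (δ + I * (a * x ^ 2 + 2 * b * x + c : ℝ))
      - (χ (x / 2) * halfCutoff χ N (-a * x + -b) : ℝ) *
        cexp (2 * Real.pi * I * y * x) /
          ((-δ : ℝ) + I * (-a * x ^ 2 + 2 * (-b) * x + -c : ℝ)) := fun x => by
    rw [← hχ.halfCutoff_add N (a * x + b),
      show ((-δ : ℝ) : ℂ) + I * (-a * x ^ 2 + 2 * (-b) * x + -c : ℝ)
        = -(δ + I * (a * x ^ 2 + 2 * b * x + c : ℝ)) by push_cast; ring,
      show -a * x + -b = -(a * x + b) by ring, div_neg, sub_neg_eq_add, ← add_div]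
    push_cast
    ring
  simp_rw [this]
  rw [integral_sub i1 i2]
  exact (norm_sub_le _ _).trans (add_le_add n1 n2)

/-- Rescaled form of `DNLS.IsBump.exists_resolvent_bound`. -/
lemma DNLS.IsBump.exists_resolvent_bound_scaled {χ : ℝ → ℝ} (hχ : IsBump χ) {N : ℝ} (hN : 1 ≤ N) :
    ∃ C : ℝ, 0 ≤ C ∧ ∀ a b c y δ l : ℝ, |a| ≤ 1 → δ ≠ 0 → 0 < l →
      ‖∫ x : ℝ, (χ (l⁻¹ * x / 2) * (1 - χ (N * l⁻¹ * (a * x + b))) : ℝ) *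
        cexp (2 * Real.pi * I * y * x) / (δ + I * (a * x ^ 2 + 2 * b * x + c : ℝ))‖
        ≤ C * l⁻¹ := by
  obtain ⟨C, hC0, hC⟩ := hχ.exists_resolvent_bound hN
  refine ⟨C, hC0, fun a b c y δ l ha hδ hl => ?_⟩
  have hl2 : l ^ 2 ≠ 0 := by positivity
  have := hC a (b / l) (c / l ^ 2) (y * l) (δ / l ^ 2) ha (div_ne_zero hδ hl2)
  have hlc : (l : ℂ) ≠ 0 := by exact_mod_cast hl.ne'
  obtain ⟨g, hg⟩ : ∃ g : ℝ → ℂ, g = fun x : ℝ => ((χ (x / 2) * (1 - χ (N * (a * x + b / l))) : ℝ) : ℂ) *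
        cexp (2 * Real.pi * I * (y * l : ℝ) * x) /
          ((δ / l ^ 2 : ℝ) + I * (a * x ^ 2 + 2 * (b / l) * x + c / l ^ 2 : ℝ)) := ⟨_, rfl⟩
  have hs : ∀ x : ℝ, ((χ (l⁻¹ * x / 2) * (1 - χ (N * l⁻¹ * (a * x + b))) : ℝ) : ℂ) *
        cexp (2 * Real.pi * I * y * x) / (δ + I * (a * x ^ 2 + 2 * b * x + c : ℝ))
      = (l ^ 2 : ℂ)⁻¹ * g (l⁻¹ * x) := by
    intro x
    simp only [hg]
    have e1 : N * (a * (l⁻¹ * x) + b / l) = N * l⁻¹ * (a * x + b) := by field_simp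
    have e2 : 2 * Real.pi * I * (y * l : ℝ) * (l⁻¹ * x : ℝ) = 2 * Real.pi * I * y * x := by
      push_cast; field_simp
    have e3 : ((δ / l ^ 2 : ℝ) : ℂ) +
        I * (a * (l⁻¹ * x) ^ 2 + 2 * (b / l) * (l⁻¹ * x) + c / l ^ 2 : ℝ)
        = (δ + I * (a * x ^ 2 + 2 * b * x + c : ℝ)) * (l ^ 2 : ℂ)⁻¹ := by
      push_cast; field_simp
    rw [e1, e2, e3, div_mul_eq_div_div, div_inv_eq_mul]
    field_simp
  rw [integral_congr_ae (.of_forall hs), integral_const_mul, Measure.integral_comp_inv_mul_left, norm_mul, norm_smul]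
  have e : ‖(l ^ 2 : ℂ)⁻¹‖ = (l ^ 2)⁻¹ := by simp
  rw [e, Real.norm_eq_abs, abs_abs, abs_of_pos hl, ← mul_assoc,
    show (l ^ 2)⁻¹ * l = l⁻¹ by field_simp, mul_comm C]
  rw [hg]
  exact mul_le_mul_of_nonneg_left this (by positivity)

end OscillatoryIntegral

section Core
open scoped SchwartzMap

variable {H : Type} [NormedAddCommGroup H] [InnerProductSpace ℝ H] [FiniteDimensional ℝ H]
  [MeasurableSpace H] [BorelSpace H]

lemma SchwartzMap.exists_decay_prod (A : 𝓢((ℝ × ℝ) × H, ℂ)) (N : ℕ) :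
    ∃ C, 0 ≤ C ∧ ∀ s r η, ‖A ((s, r), η)‖
      ≤ C * (1 + s ^ 2)⁻¹ * (1 + r ^ 2)⁻¹ * (1 + ‖η‖) ^ (-(N : ℝ)) := by
  obtain ⟨C₀, h₀, d₀⟩ := A.exists_decay_snd 0 N
  obtain ⟨C₂, h₂, d₂⟩ := A.exists_decay_snd 2 N
  obtain ⟨C₄, h₄, d₄⟩ := A.exists_decay_snd 4 N
  refine ⟨C₀ + 2 * C₂ + C₄, by positivity, fun s r η => ?_⟩
  have hs : s ^ 2 ≤ ‖(s, r)‖ ^ 2 := by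
    rw [← sq_abs]
    exact pow_le_pow_left₀ (abs_nonneg _) (norm_fst_le (s, r)) 2
  have hr : r ^ 2 ≤ ‖(s, r)‖ ^ 2 := by
    rw [← sq_abs]
    exact pow_le_pow_left₀ (abs_nonneg _) (norm_snd_le (s, r)) 2
  have key : (1 + s ^ 2) * (1 + r ^ 2) * ‖A ((s, r), η)‖
      ≤ (C₀ + 2 * C₂ + C₄) * (1 + ‖η‖) ^ (-(N : ℝ)) := by
    calc (1 + s ^ 2) * (1 + r ^ 2) * ‖A ((s, r), η)‖
        ≤ (1 + ‖(s, r)‖ ^ 2) * (1 + ‖(s, r)‖ ^ 2) * ‖A ((s, r), η)‖ := by gcongr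
      _ = ‖(s, r)‖ ^ 0 * ‖A ((s, r), η)‖ + 2 * (‖(s, r)‖ ^ 2 * ‖A ((s, r), η)‖)
          + ‖(s, r)‖ ^ 4 * ‖A ((s, r), η)‖ := by ring
      _ ≤ C₀ * (1 + ‖η‖) ^ (-(N : ℝ)) + 2 * (C₂ * (1 + ‖η‖) ^ (-(N : ℝ)))
          + C₄ * (1 + ‖η‖) ^ (-(N : ℝ)) := by
          exact add_le_add (add_le_add (d₀ _ _) (mul_le_mul_of_nonneg_left (d₂ _ _) zero_le_two))
            (d₄ _ _)
      _ = _ := by ring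
  rw [← div_eq_mul_inv, ← div_eq_mul_inv, div_div, div_mul_eq_mul_div, le_div_iff₀ (by positivity)]
  linarith

/-- The kernel of the propagator, localised by `m`, along one coordinate axis. -/
def axisKernel (m : ℝ → H → ℂ) (q : ℝ → H → ℝ) (η : H) (y θ : ℝ) : ℂ :=
  ∫ ρ : ℝ, m ρ η * cexp (2 * Real.pi * I * y * ρ) * cexp (-I * θ * q ρ η)

/-- An amplitude which is continuous, bounded by `B` and supported in `|ρ| ≤ R`. -/
structure IsAmplitude (m : ℝ → H → ℂ) (R B : ℝ) : Prop where
  continuous : Continuous fun p : ℝ × H => m p.1 p.2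
  bound : ∀ ρ η, ‖m ρ η‖ ≤ B
  supp : ∀ ρ η, R < |ρ| → m ρ η = 0

variable {m : ℝ → H → ℂ} {q : ℝ → H → ℝ} {R B : ℝ}

lemma IsAmplitude.norm_le (hm : IsAmplitude m R B) (ρ : ℝ) (η : H) :
    ‖m ρ η‖ ≤ (Set.Icc (-R) R).indicator (fun _ => B) ρ := by
  by_cases hx : ρ ∈ Set.Icc (-R) R
  · rw [Set.indicator_of_mem hx]; exact hm.bound ρ η
  · rw [Set.indicator_of_notMem hx, hm.supp, norm_zero]
    rw [Set.mem_Icc, ← abs_le] at hx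
    exact not_le.1 hx

lemma integrable_indicator_Icc_const (R B : ℝ) :
    Integrable ((Set.Icc (-R) R).indicator fun _ => B) :=
  (integrable_indicator_iff measurableSet_Icc).2 (integrableOn_const (by simp))

lemma norm_cexp_two_pi_mul (y ρ : ℝ) : ‖cexp (2 * Real.pi * I * y * ρ)‖ = 1 := by
  rw [Complex.norm_exp]; simp

lemma norm_cexp_neg_I_mul (θ q : ℝ) : ‖cexp (-I * θ * q)‖ = 1 := by
  rw [Complex.norm_exp]; simp

lemma IsAmplitude.continuous_axisKernel (hm : IsAmplitude m R B)
    (hq : Continuous fun p : ℝ × H => q p.1 p.2) :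
    Continuous fun p : H × ℝ × ℝ => axisKernel m q p.1 p.2.1 p.2.2 := by
  have h : (fun p : H × ℝ × ℝ => axisKernel m q p.1 p.2.1 p.2.2) = fun p =>
      ∫ ρ in Set.Icc (-R) R, m ρ p.1 * cexp (2 * Real.pi * I * p.2.1 * ρ)
        * cexp (-I * p.2.2 * q ρ p.1) := by
    ext p
    refine (setIntegral_eq_integral_of_forall_compl_eq_zero fun ρ hρ => ?_).symm
    rw [Set.mem_Icc, ← abs_le] at hρ
    rw [hm.supp ρ _ (not_le.1 hρ)]
    simp
  rw [h]
  refine continuous_parametric_integral_of_continuous ?_ isCompact_Icc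
  have h1 : Continuous fun p : (H × ℝ × ℝ) × ℝ => m p.2 p.1.1 :=
    hm.continuous.comp (by fun_prop : Continuous fun p : (H × ℝ × ℝ) × ℝ => (p.2, p.1.1))
  have h2 : Continuous fun p : (H × ℝ × ℝ) × ℝ => q p.2 p.1.1 :=
    hq.comp (by fun_prop : Continuous fun p : (H × ℝ × ℝ) × ℝ => (p.2, p.1.1))
  exact (h1.mul (by fun_prop)).mul (Complex.continuous_exp.comp
    ((by fun_prop : Continuous fun p : (H × ℝ × ℝ) × ℝ => -I * (p.1.2.2 : ℂ)).mul
      (Complex.continuous_ofReal.comp h2)))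

lemma IsAmplitude.norm_axisKernel_le (hm : IsAmplitude m R B) (η : H) (y θ : ℝ) :
    ‖axisKernel m q η y θ‖ ≤ ∫ ρ, (Set.Icc (-R) R).indicator (fun _ => B) ρ := by
  refine norm_integral_le_of_norm_le (integrable_indicator_Icc_const R B) (.of_forall fun ρ => ?_)
  rw [norm_mul, norm_mul, norm_cexp_two_pi_mul, norm_cexp_neg_I_mul, mul_one, mul_one]
  exact hm.norm_le ρ η

/-- The one-sided Laplace transform of the kernel is a resolvent integral. -/
lemma IsAmplitude.laplace_axisKernel (hm : IsAmplitude m R B)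
    (hq : Continuous fun p : ℝ × H => q p.1 p.2) (η : H) (y σ δ τ : ℝ) (hδ : 0 < δ) :
    ∫ θ in Set.Ioi (0 : ℝ), cexp (-(2 * Real.pi * τ * I) * θ) *
      (cexp (-δ * θ) * axisKernel m q η y ((σ * θ : ℝ)))
    = ∫ ρ : ℝ, m ρ η * cexp (2 * Real.pi * I * y * ρ)
        / (δ + I * (σ * q ρ η + 2 * Real.pi * τ : ℝ)) := by
  have hmη : Continuous fun ρ => m ρ η :=
    hm.continuous.comp (by fun_prop : Continuous fun ρ : ℝ => (ρ, η))
  have hqη : Continuous fun ρ => q ρ η :=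
    hq.comp (by fun_prop : Continuous fun ρ : ℝ => (ρ, η))
  have hm0 : Integrable fun ρ => m ρ η :=
    (integrable_indicator_Icc_const R B).mono' hmη.aestronglyMeasurable
      (.of_forall fun ρ => hm.norm_le ρ η)
  have hint : Integrable (fun p : ℝ × ℝ => m p.2 η * cexp (2 * Real.pi * I * y * p.2) *
      cexp (-(δ + I * (σ * q p.2 η + 2 * Real.pi * τ : ℝ)) * p.1))
      ((volume.restrict (Set.Ioi (0 : ℝ))).prod volume) := by
    have h1 : Integrable (fun p : ℝ × ℝ => ((Real.exp (-δ * p.1) : ℝ) : ℂ) * m p.2 η)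
        ((volume.restrict (Set.Ioi (0 : ℝ))).prod volume) :=
      Integrable.mul_prod (f := fun s => ((Real.exp (-δ * s) : ℝ) : ℂ))
        (exp_neg_integrableOn_Ioi 0 hδ).ofReal hm0
    refine h1.mono (Continuous.aestronglyMeasurable ?_) (.of_forall fun p => le_of_eq ?_)
    · have c1 : Continuous fun p : ℝ × ℝ => m p.2 η := hmη.comp continuous_snd
      have c2 : Continuous fun p : ℝ × ℝ => q p.2 η := hqη.comp continuous_snd
      fun_prop
    · rw [norm_mul, norm_mul, norm_mul, norm_cexp_two_pi_mul, mul_one, mul_comm,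
        Complex.norm_exp, Complex.norm_real, Real.norm_of_nonneg (Real.exp_pos _).le]
      simp
  calc _ = ∫ θ in Set.Ioi (0 : ℝ), ∫ ρ : ℝ, m ρ η * cexp (2 * Real.pi * I * y * ρ) *
      cexp (-(δ + I * (σ * q ρ η + 2 * Real.pi * τ : ℝ)) * θ) := by
        refine integral_congr_ae (.of_forall fun θ => ?_)
        simp only [axisKernel]
        rw [← integral_const_mul, ← integral_const_mul]
        refine integral_congr_ae (.of_forall fun ρ => ?_)
        have : cexp (-(δ + I * (σ * q ρ η + 2 * Real.pi * τ : ℝ)) * θ)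
          = cexp (-(2 * Real.pi * τ * I) * θ) * (cexp (-δ * θ) * cexp (-I * (σ * θ : ℝ) * q ρ η)) := by
          rw [← Complex.exp_add, ← Complex.exp_add]; push_cast; ring_nf
        dsimp only
        rw [this]; ring
    _ = ∫ ρ : ℝ, ∫ θ in Set.Ioi (0 : ℝ), m ρ η * cexp (2 * Real.pi * I * y * ρ) *
      cexp (-(δ + I * (σ * q ρ η + 2 * Real.pi * τ : ℝ)) * θ) := integral_integral_swap hint
    _ = _ := by
        refine integral_congr_ae (.of_forall fun ρ => ?_)
        dsimp only
        rw [integral_const_mul, integral_exp_mul_complex_Ioi (by simpa using hδ), div_eq_mul_inv]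
        congr 1
        simp only [ofReal_zero, mul_zero, Complex.exp_zero]
        rw [inv_neg, neg_one_mul, neg_neg]

/-- Duhamel's formula along one coordinate axis. -/
def axisDuhamel (m : ℝ → H → ℂ) (q : ℝ → H → ℝ) (g : 𝓢((ℝ × ℝ) × H, ℂ)) (r t r' : ℝ) (η : H) : ℂ :=
  ∫ s in (0 : ℝ)..t, axisKernel m q η (r - r') (t - s) * g ((s, r'), η)

lemma IsAmplitude.continuous_axisDuhamel (hm : IsAmplitude m R B)
    (hq : Continuous fun p : ℝ × H => q p.1 p.2) (g : 𝓢((ℝ × ℝ) × H, ℂ)) (r : ℝ) :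
    Continuous fun p : (ℝ × H) × ℝ => axisDuhamel m q g r p.1.1 p.2 p.1.2 := by
  unfold axisDuhamel
  refine intervalIntegral.continuous_parametric_intervalIntegral_of_continuous
    (f := fun (p : (ℝ × H) × ℝ) s =>
      axisKernel m q p.1.2 (r - p.2) (p.1.1 - s) * g ((s, p.2), p.1.2)) ?_ (by fun_prop)
  refine Continuous.mul ?_ ?_
  · exact (hm.continuous_axisKernel hq).comp (by fun_prop :
      Continuous fun p : ((ℝ × H) × ℝ) × ℝ => (p.1.1.2, r - p.1.2, p.1.1.1 - p.2))
  · exact g.continuous.comp (by fun_prop)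

lemma IsAmplitude.integrable_axisDuhamel (hm : IsAmplitude m R B)
    (hq : Continuous fun p : ℝ × H => q p.1 p.2) (g : 𝓢((ℝ × ℝ) × H, ℂ)) (r t : ℝ) :
    Integrable fun p : H × ℝ => axisDuhamel m q g r t p.2 p.1 := by
  obtain ⟨C, hC, h⟩ := g.exists_decay_prod (Module.finrank ℝ H + 1)
  set L := ∫ ρ, (Set.Icc (-R) R).indicator (fun _ => B) ρ
  have hL : 0 ≤ L := (norm_nonneg _).trans (hm.norm_axisKernel_le (q := q) 0 0 0)
  have hi : Integrable fun p : H × ℝ =>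
      (1 + ‖p.1‖) ^ (-((Module.finrank ℝ H + 1 : ℕ) : ℝ)) * (L * C * |t| * (1 + p.2 ^ 2)⁻¹) :=
    integrable_one_add_norm_finrank.mul_prod (integrable_inv_one_add_sq.const_mul _)
  refine hi.mono' (Continuous.aestronglyMeasurable ?_) (.of_forall fun p => ?_)
  · exact (hm.continuous_axisDuhamel hq g r).comp
      (by fun_prop : Continuous fun p : H × ℝ => ((t, p.1), p.2))
  · have := intervalIntegral.norm_integral_le_of_norm_le_const (a := 0) (b := t)
      (f := fun s => axisKernel m q p.1 (r - p.2) (t - s) * g ((s, p.2), p.1))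
      (C := L * (C * (1 + p.2 ^ 2)⁻¹ * (1 + ‖p.1‖) ^ (-((Module.finrank ℝ H + 1 : ℕ) : ℝ))))
      (fun s _ => by
        rw [norm_mul]
        gcongr
        · exact hm.norm_axisKernel_le _ _ _
        · refine (h s p.2 p.1).trans ?_
          gcongr
          refine mul_le_of_le_one_right hC (inv_le_one_of_one_le₀ ?_)
          nlinarith [sq_nonneg s])
    refine this.trans (le_of_eq ?_)
    rw [sub_zero]
    ring

lemma IsAmplitude.lintegral_axisDuhamel_time_le (hm : IsAmplitude m R B)
    (hq : Continuous fun p : ℝ × H => q p.1 p.2) (g : 𝓢((ℝ × ℝ) × H, ℂ)) {A : ℝ} (η : H)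
    (hA : ∀ y σ δ τ : ℝ, (σ = 1 ∨ σ = -1) → 0 < δ →
      ‖∫ ρ : ℝ, m ρ η * cexp (2 * Real.pi * I * y * ρ)
        / (δ + I * (σ * q ρ η + 2 * Real.pi * τ : ℝ))‖ ≤ A) (r r' : ℝ) :
    ∫⁻ t : ℝ, ‖axisDuhamel m q g r t r' η‖ₑ ^ 2
      ≤ ENNReal.ofReal A ^ 2 * ∫⁻ s : ℝ, ‖g ((s, r'), η)‖ₑ ^ 2 := by
  obtain ⟨C, hC, h⟩ := g.exists_decay_prod 0
  have hb : ∀ s, ‖g ((s, r'), η)‖ ≤ C * (1 + s ^ 2)⁻¹ := fun s => by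
    refine (h s r' η).trans ?_
    simp only [Nat.cast_zero, neg_zero, Real.rpow_zero, mul_one]
    refine mul_le_of_le_one_right (by positivity) (inv_le_one_of_one_le₀ ?_)
    nlinarith [sq_nonneg r']
  have hgc : Continuous fun s : ℝ => g ((s, r'), η) := g.continuous.comp (by fun_prop)
  have hi : Integrable fun s => g ((s, r'), η) :=
    (integrable_inv_one_add_sq.const_mul C).mono' hgc.aestronglyMeasurable (.of_forall hb)
  have hi2 : MemLp (fun s => g ((s, r'), η)) 2 :=
    memLp_two_of_integrable_of_bound hi (B := C) fun s => (hb s).trans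
      (mul_le_of_le_one_right hC (inv_le_one_of_one_le₀ (by nlinarith [sq_nonneg s])))
  have hK : Continuous fun θ : ℝ => axisKernel m q η (r - r') θ :=
    (hm.continuous_axisKernel hq).comp (by fun_prop : Continuous fun θ : ℝ => (η, r - r', θ))
  refine volterra_sq_le (K := axisKernel m q η (r - r')) hK
    (fun θ => hm.norm_axisKernel_le η _ θ) hi hi2 fun σ hσ δ hδ τ => ?_
  rw [hm.laplace_axisKernel hq η _ σ δ τ hδ]
  exact hA _ σ δ τ hσ hδ

lemma SchwartzMap.lintegral_partialFourierSchwartz_sq (Γ : 𝓢((ℝ × ℝ) × H, ℂ)) (s r' : ℝ) :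
    ∫⁻ η : H, ‖partialFourierSchwartz Γ ((s, r'), η)‖ₑ ^ 2 = ∫⁻ v : H, ‖Γ ((s, r'), v)‖ₑ ^ 2 := by
  obtain ⟨C, hC, h⟩ := Γ.exists_decay_snd 0 0
  have hi := Γ.integrable_slice (s, r')
  have h2 := memLp_two_of_integrable_of_bound hi (B := C) fun v => by simpa using h (s, r') v
  rw [← lintegral_enorm_fourier_sq hi h2]
  exact lintegral_congr fun η => by rw [partialFourierSchwartz_apply]

lemma IsAmplitude.lintegral_axisDuhamel_le (hm : IsAmplitude m R B)
    (hq : Continuous fun p : ℝ × H => q p.1 p.2) (g : 𝓢((ℝ × ℝ) × H, ℂ)) {A : ℝ}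
    (hA : ∀ (η : H) (y σ δ τ : ℝ), (σ = 1 ∨ σ = -1) → 0 < δ →
      ‖∫ ρ : ℝ, m ρ η * cexp (2 * Real.pi * I * y * ρ)
        / (δ + I * (σ * q ρ η + 2 * Real.pi * τ : ℝ))‖ ≤ A) (r r' : ℝ) :
    ∫⁻ p : ℝ × H, ‖axisDuhamel m q g r p.1 r' p.2‖ₑ ^ 2
      ≤ ENNReal.ofReal A ^ 2 * ∫⁻ s : ℝ, ∫⁻ η : H, ‖g ((s, r'), η)‖ₑ ^ 2 := by
  have c1 : Measurable fun p : ℝ × H => ‖axisDuhamel m q g r p.1 r' p.2‖ₑ ^ 2 :=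
    ((hm.continuous_axisDuhamel hq g r).comp
      (by fun_prop : Continuous fun p : ℝ × H => (p, r'))).enorm.measurable.pow_const 2
  have c2 : Measurable fun p : H × ℝ => ‖g ((p.2, r'), p.1)‖ₑ ^ 2 :=
    (g.continuous.comp
      (by fun_prop : Continuous fun p : H × ℝ => ((p.2, r'), p.1))).enorm.measurable.pow_const 2
  rw [Measure.volume_eq_prod, lintegral_prod_symm _ c1.aemeasurable,
    ← lintegral_lintegral_swap (f := fun η s => ‖g ((s, r'), η)‖ₑ ^ 2) c2.aemeasurable,
    ← lintegral_const_mul _ (Measurable.lintegral_prod_right c2)]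
  exact lintegral_mono fun η => hm.lintegral_axisDuhamel_time_le hq g η (hA η) r r'

/-- The `L²` estimate behind local smoothing, after a Fourier transform in `H`. -/
lemma IsAmplitude.lintegral_fourierInv_axisDuhamel_le (hm : IsAmplitude m R B)
    (hq : Continuous fun p : ℝ × H => q p.1 p.2) (Γ : 𝓢((ℝ × ℝ) × H, ℂ)) {A : ℝ}
    (hA : ∀ (η : H) (y σ δ τ : ℝ), (σ = 1 ∨ σ = -1) → 0 < δ →
      ‖∫ ρ : ℝ, m ρ η * cexp (2 * Real.pi * I * y * ρ)
        / (δ + I * (σ * q ρ η + 2 * Real.pi * τ : ℝ))‖ ≤ A) (r : ℝ) :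
    ∫⁻ t : ℝ, ∫⁻ v : H,
        ‖𝓕⁻ (fun η => ∫ r', axisDuhamel m q (partialFourierSchwartz Γ) r t r' η) v‖ₑ ^ 2
      ≤ (ENNReal.ofReal A *
        ∫⁻ r', (∫⁻ s : ℝ, ∫⁻ v : H, ‖Γ ((s, r'), v)‖ₑ ^ 2) ^ (1 / 2 : ℝ)) ^ 2 := by
  have hT := hm.continuous_axisDuhamel hq (partialFourierSchwartz Γ) r
  have hA2 : ENNReal.ofReal A = (ENNReal.ofReal A ^ 2) ^ (1 / 2 : ℝ) := by
    rw [← ENNReal.rpow_natCast, ← ENNReal.rpow_mul]; norm_num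
  calc _ ≤ ∫⁻ t : ℝ, ∫⁻ η : H, ‖∫ r', axisDuhamel m q (partialFourierSchwartz Γ) r t r' η‖ₑ ^ 2 :=
        lintegral_mono fun t => lintegral_enorm_fourierInv_sq_le
          (hm.integrable_axisDuhamel hq _ r t).integral_prod_left
    _ ≤ ∫⁻ t : ℝ, ∫⁻ η : H, (∫⁻ r', ‖axisDuhamel m q (partialFourierSchwartz Γ) r t r' η‖ₑ) ^ 2 :=
        lintegral_mono fun t => lintegral_mono fun η =>
          pow_le_pow_left₀ zero_le (enorm_integral_le_lintegral_enorm _) 2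
    _ = ∫⁻ p : ℝ × H, (∫⁻ r', ‖axisDuhamel m q (partialFourierSchwartz Γ) r p.1 r' p.2‖ₑ) ^ 2 := by
        rw [Measure.volume_eq_prod, lintegral_prod]
        exact ((Measurable.lintegral_prod_right hT.enorm.measurable).pow_const 2).aemeasurable
    _ ≤ (∫⁻ r', (∫⁻ p : ℝ × H,
          ‖axisDuhamel m q (partialFourierSchwartz Γ) r p.1 r' p.2‖ₑ ^ 2) ^ (1 / 2 : ℝ)) ^ 2 :=
        lintegral_lintegral_sq_le volume volume hT.enorm.measurable
    _ ≤ (∫⁻ r', ENNReal.ofReal A *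
          (∫⁻ s : ℝ, ∫⁻ v : H, ‖Γ ((s, r'), v)‖ₑ ^ 2) ^ (1 / 2 : ℝ)) ^ 2 := by
        refine pow_le_pow_left₀ zero_le (lintegral_mono fun r' => ?_) 2
        rw [hA2, ← ENNReal.mul_rpow_of_nonneg _ _ (by norm_num)]
        simp_rw [← Γ.lintegral_partialFourierSchwartz_sq]
        exact ENNReal.rpow_le_rpow (hm.lintegral_axisDuhamel_le hq _ hA r r') (by norm_num)
    _ = _ := by
        rw [lintegral_const_mul' _ _ ENNReal.ofReal_ne_top]

end Core

section Core
open scoped SchwartzMap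

lemma integral_integral_integral_rev {X Y Z : Type*} [MeasurableSpace X] [MeasurableSpace Y]
    [MeasurableSpace Z] {μ : Measure X} {ν : Measure Y} {κ : Measure Z} [SFinite μ] [SFinite ν]
    [SFinite κ] {Φ : X → Y → Z → ℂ}
    (h : Integrable (fun p : X × Y × Z => Φ p.1 p.2.1 p.2.2) (μ.prod (ν.prod κ))) :
    ∫ x, ∫ y, ∫ z, Φ x y z ∂κ ∂ν ∂μ = ∫ z, ∫ y, ∫ x, Φ x y z ∂μ ∂ν ∂κ := by
  calc _ = ∫ x, ∫ w : Y × Z, Φ x w.1 w.2 ∂(ν.prod κ) ∂μ := by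
        refine integral_congr_ae ?_
        filter_upwards [h.prod_right_ae] with x hx
        exact (integral_prod _ hx).symm
    _ = ∫ w : Y × Z, ∫ x, Φ x w.1 w.2 ∂μ ∂(ν.prod κ) :=
        integral_integral_swap (f := fun x (w : Y × Z) => Φ x w.1 w.2) h
    _ = _ := integral_prod_symm _ h.integral_prod_right

variable {H : Type} [NormedAddCommGroup H] [InnerProductSpace ℝ H]
  [FiniteDimensional ℝ H] [MeasurableSpace H] [BorelSpace H] {m : ℝ → H → ℂ} {q : ℝ → H → ℝ} {R B : ℝ}

lemma IsAmplitude.integral_axisDuhamel (hm : IsAmplitude m R B)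
    (hq : Continuous fun p : ℝ × H => q p.1 p.2) (g : 𝓢((ℝ × ℝ) × H, ℂ)) (r t : ℝ) (η : H) :
    ∫ ρ : ℝ, cexp (2 * Real.pi * I * r * ρ) * ∫ s in (0 : ℝ)..t,
        m ρ η * (cexp (-I * (t - s : ℝ) * q ρ η)
          * ∫ r' : ℝ, cexp (-(2 * Real.pi * I * r' * ρ)) * g ((s, r'), η))
      = ∫ r', axisDuhamel m q g r t r' η := by
  obtain ⟨C, hC, h⟩ := g.exists_decay_prod 0
  have hmη : Continuous fun ρ => m ρ η :=
    hm.continuous.comp (by fun_prop : Continuous fun ρ : ℝ => (ρ, η))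
  have hqη : Continuous fun ρ => q ρ η :=
    hq.comp (by fun_prop : Continuous fun ρ : ℝ => (ρ, η))
  have hgη : Continuous fun p : ℝ × ℝ => g (p, η) := g.continuous.comp (by fun_prop)
  have hb : ∀ s r', ‖g ((s, r'), η)‖ ≤ C * (1 + r' ^ 2)⁻¹ := fun s r' => by
    refine (h s r' η).trans ?_
    simp only [Nat.cast_zero, neg_zero, Real.rpow_zero, mul_one]
    gcongr
    refine mul_le_of_le_one_right hC (inv_le_one_of_one_le₀ ?_)
    nlinarith [sq_nonneg s]
  set Φ : ℝ → ℝ → ℝ → ℂ := fun ρ s r' => m ρ η * cexp (2 * Real.pi * I * (r - r' : ℝ) * ρ)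
    * cexp (-I * (t - s : ℝ) * q ρ η) * g ((s, r'), η) with hΦ
  have hi : Integrable (fun p : ℝ × ℝ × ℝ => Φ p.1 p.2.1 p.2.2)
      (volume.prod ((volume.restrict (Set.uIoc 0 t)).prod volume)) := by
    have : IsFiniteMeasure (volume.restrict (Set.uIoc 0 t)) := ⟨by simp [Set.uIoc]⟩
    have h1 : Integrable (fun p : ℝ × ℝ × ℝ =>
        (Set.Icc (-R) R).indicator (fun _ => B) p.1 * ((1 : ℝ) * (C * (1 + p.2.2 ^ 2)⁻¹)))
        (volume.prod ((volume.restrict (Set.uIoc 0 t)).prod volume)) :=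
      (integrable_indicator_Icc_const R B).mul_prod
        ((integrable_const (1 : ℝ)).mul_prod (integrable_inv_one_add_sq.const_mul C))
    refine h1.mono' (Continuous.aestronglyMeasurable ?_) (.of_forall fun p => ?_)
    · have c1 : Continuous fun p : ℝ × ℝ × ℝ => m p.1 η := hmη.comp continuous_fst
      have c2 : Continuous fun p : ℝ × ℝ × ℝ => q p.1 η := hqη.comp continuous_fst
      have c3 : Continuous fun p : ℝ × ℝ × ℝ => g (p.2, η) := hgη.comp continuous_snd
      simp only [hΦ]
      exact ((c1.mul (by fun_prop)).mul (Complex.continuous_exp.comp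
        ((by fun_prop : Continuous fun p : ℝ × ℝ × ℝ => -I * ((t - p.2.1 : ℝ) : ℂ)).mul
          (Complex.continuous_ofReal.comp c2)))).mul c3
    · simp only [hΦ]
      rw [norm_mul, norm_mul, norm_mul, norm_cexp_two_pi_mul, norm_cexp_neg_I_mul, mul_one, mul_one,
        one_mul]
      exact mul_le_mul (hm.norm_le _ _) (hb _ _) (norm_nonneg _)
        ((norm_nonneg _).trans (hm.norm_le p.1 η))
  simp only [axisDuhamel, intervalIntegral.intervalIntegral_eq_integral_uIoc]
  simp only [mul_smul_comm, integral_smul]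
  congr 1
  calc _ = ∫ ρ, ∫ s in Set.uIoc 0 t, ∫ r', Φ ρ s r' := by
        refine integral_congr_ae (.of_forall fun ρ => ?_)
        dsimp only
        rw [← integral_const_mul]
        refine integral_congr_ae (.of_forall fun s => ?_)
        dsimp only
        rw [← integral_const_mul, ← integral_const_mul, ← integral_const_mul]
        refine integral_congr_ae (.of_forall fun r' => ?_)
        have : cexp (2 * Real.pi * I * (r - r' : ℝ) * ρ)
            = cexp (2 * Real.pi * I * r * ρ) * cexp (-(2 * Real.pi * I * r' * ρ)) := by
          rw [← Complex.exp_add]; push_cast; ring_nf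
        simp only [hΦ]
        rw [this]; ring
    _ = _ := integral_integral_integral_rev hi
    _ = _ := by
        refine integral_congr_ae (.of_forall fun r' => integral_congr_ae (.of_forall fun s => ?_))
        simp only [axisKernel]
        rw [← integral_mul_const]

end Core

section Symbols

lemma DNLS.IsBump.apply_abs {χ : ℝ → ℝ} (hχ : IsBump χ) (s : ℝ) : χ |s| = χ s := by
  rcases abs_choice s with h | h <;> rw [h]
  exact hχ.even s

lemma DNLS.IsBump.psiR_eq {χ : ℝ → ℝ} (hχ : IsBump χ) (s : ℝ) : psiR χ s = χ s - χ (2 * s) := by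
  have : 2 * |s| = |2 * s| := by rw [abs_mul, abs_two]
  rw [psiR, this, hχ.apply_abs, hχ.apply_abs]

/-- The sum defining `ψ_{≥k}` telescopes. -/
lemma DNLS.IsBump.psiGe_eq {χ : ℝ → ℝ} (hχ : IsBump χ) (k : ℤ) (s : ℝ) :
    psiGe χ k s = 1 - χ (2 * ((2 : ℝ) ^ (-k) * s)) := by
  obtain ⟨M, hM⟩ : ∃ M : ℕ, 2 * ((2 : ℝ) ^ (-k) * |s|) ≤ 2 ^ M := by
    obtain ⟨M, hM⟩ := pow_unbounded_of_one_lt (2 * ((2 : ℝ) ^ (-k) * |s|)) one_lt_two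
    exact ⟨M, hM.le⟩
  set f : ℕ → ℝ := fun i => χ (2 * ((2 : ℝ) ^ (-(k + i)) * s)) with hf
  have hpow : ∀ i : ℕ, (2 : ℝ) ^ (-(k + i)) = 2 ^ (-k) * ((2 : ℝ) ^ i)⁻¹ := fun i => by
    rw [neg_add, zpow_add₀ two_ne_zero, zpow_neg _ (i : ℤ), zpow_natCast]
  have hterm : ∀ i : ℕ, psiR χ ((2 : ℝ) ^ (-(k + i)) * s) = f (i + 1) - f i := fun i => by
    rw [hχ.psiR_eq, hf]
    simp only
    congr 2
    rw [hpow, hpow, pow_succ]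
    field_simp
  have hone : ∀ i, M ≤ i → f i = 1 := fun i hi => by
    refine hχ.one _ ?_
    rw [hpow, abs_mul, abs_mul, abs_mul, abs_two, abs_of_pos (zpow_pos two_pos _),
      abs_of_pos (by positivity : (0 : ℝ) < ((2 : ℝ) ^ i)⁻¹)]
    have : (2 : ℝ) ^ M ≤ 2 ^ i := pow_le_pow_right₀ one_le_two hi
    calc 2 * ((2 : ℝ) ^ (-k) * (2 ^ i)⁻¹ * |s|) = (2 * ((2 : ℝ) ^ (-k) * |s|)) / 2 ^ i := by ring
      _ ≤ 1 := (div_le_one (by positivity)).2 (hM.trans this)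
  let φ : ℕ ↪ ℤ := ⟨fun i => k + i, fun a b h => by simpa using h⟩
  rw [psiGe, tsum_eq_sum (s := (Finset.range M).map φ)]
  · rw [Finset.sum_map]
    have : ∀ i ∈ Finset.range M, (if k ≤ φ i then psiR χ ((2 : ℝ) ^ (-(φ i)) * s) else 0)
        = f (i + 1) - f i := fun i _ =>
      (if_pos (show k ≤ k + (i : ℤ) by omega)).trans (hterm i)
    rw [Finset.sum_congr rfl this, Finset.sum_range_sub, hone M le_rfl]
    simp [hf]
  · intro b hb
    split_ifs with hkb
    · obtain ⟨i, rfl⟩ := Int.le.dest hkb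
      have hi : M ≤ i := by
        by_contra! hlt
        exact hb (Finset.mem_map.2 ⟨i, Finset.mem_range.2 hlt, rfl⟩)
      rw [hterm, hone _ hi, hone _ (by omega), sub_self]
    · rfl

variable {n : ℕ}

lemma abs_quadSym_le {ε : Fin n → ℝ} (hε : ∀ i, ε i = 1 ∨ ε i = -1) (ξ : Eucl n) :
    |quadSym ε ξ| ≤ ‖ξ‖ ^ 2 := by
  rw [EuclideanSpace.norm_sq_eq, quadSym]
  refine (Finset.abs_sum_le_sum_abs _ _).trans (Finset.sum_le_sum fun i _ => ?_)
  rw [abs_mul, Real.norm_eq_abs, abs_of_nonneg (sq_nonneg (ξ i)), sq_abs]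
  rcases hε i with h | h <;> simp [h]

lemma quadSym_smul_add (ε : Fin n → ℝ) (e η : Eucl n) (ρ : ℝ) :
    quadSym ε (ρ • e + η)
      = quadSym ε e * ρ ^ 2 + 2 * (inner ℝ η (epm ε e) : ℝ) * ρ + quadSym ε η := by
  simp only [quadSym, epm, PiLp.inner_apply, Finset.sum_mul, Finset.mul_sum,
    ← Finset.sum_add_distrib]
  refine Finset.sum_congr rfl fun i _ => ?_
  simp
  ring

lemma inner_epm_smul_add (ε : Fin n → ℝ) (e η : Eucl n) (ρ : ℝ) :
    (inner ℝ (ρ • e + η) (epm ε e) : ℝ) = quadSym ε e * ρ + inner ℝ η (epm ε e) := by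
  rw [inner_add_left, inner_smul_left]
  congr 1
  simp only [quadSym, epm, PiLp.inner_apply, Finset.sum_mul, Finset.mul_sum]
  refine Finset.sum_congr rfl fun i _ => ?_
  simp
  ring

end Symbols

section TimeIntegral
open scoped SchwartzMap

variable {E : Type} [NormedAddCommGroup E] [InnerProductSpace ℝ E] [FiniteDimensional ℝ E]
  [MeasurableSpace E] [BorelSpace E]

lemma SchwartzMap.integrable_timeIntegrand (A : 𝓢(ℝ × E, ℂ)) (t : ℝ) :
    Integrable (fun p : E × ℝ => A (p.2, p.1)) (volume.prod (volume.restrict (Set.uIoc 0 t))) := by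
  obtain ⟨C, hC, h⟩ := A.exists_decay_snd 0 (Module.finrank ℝ E + 1)
  have : IsFiniteMeasure (volume.restrict (Set.uIoc 0 t)) := ⟨by simp [Set.uIoc]⟩
  refine ((integrable_one_add_norm_finrank (E := E)).mul_prod (integrable_const C)).mono'
    (A.continuous.comp (by fun_prop)).aestronglyMeasurable (.of_forall fun p => ?_)
  rw [mul_comm]
  simpa using h p.2 p.1

lemma SchwartzMap.integrable_timeIntegral (A : 𝓢(ℝ × E, ℂ)) (t : ℝ) :
    Integrable fun ξ => ∫ s in (0 : ℝ)..t, A (s, ξ) := by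
  simp only [intervalIntegral.intervalIntegral_eq_integral_uIoc]
  exact (A.integrable_timeIntegrand t).integral_prod_left.smul _

lemma SchwartzMap.continuous_timeIntegral (A : 𝓢(ℝ × E, ℂ)) (t : ℝ) :
    Continuous fun ξ => ∫ s in (0 : ℝ)..t, A (s, ξ) :=
  intervalIntegral.continuous_parametric_intervalIntegral_of_continuous
    (f := fun ξ s => A (s, ξ)) (A.continuous.comp (by fun_prop)) continuous_const

lemma SchwartzMap.fourierInv_timeIntegral (A : 𝓢(ℝ × E, ℂ)) (t : ℝ) (x : E) :
    𝓕⁻ (fun ξ => ∫ s in (0 : ℝ)..t, A (s, ξ)) x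
      = ∫ s in (0 : ℝ)..t, 𝓕⁻ (fun ξ => A (s, ξ)) x := by
  simp only [Real.fourierInv_eq', intervalIntegral.intervalIntegral_eq_integral_uIoc, smul_eq_mul,
    mul_smul_comm, integral_smul, ← integral_const_mul]
  congr 1
  refine integral_integral_swap ?_
  refine (A.integrable_timeIntegrand t).mono (Continuous.aestronglyMeasurable ?_)
    (.of_forall fun p => le_of_eq ?_)
  · have : Continuous fun p : E × ℝ => A (p.2, p.1) := A.continuous.comp (by fun_prop)
    simp only [Function.uncurry_def]
    fun_prop
  · simp only [Function.uncurry_def]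
    rw [norm_mul, Complex.norm_exp_ofReal_mul_I, one_mul]

lemma SchwartzMap.fourier_fourierInv_timeIntegral (A : 𝓢(ℝ × E, ℂ)) (t : ℝ) :
    𝓕 (𝓕⁻ fun ξ => ∫ s in (0 : ℝ)..t, A (s, ξ)) = fun ξ => ∫ s in (0 : ℝ)..t, A (s, ξ) := by
  refine (A.continuous_timeIntegral t).fourier_fourierInv_eq (A.integrable_timeIntegral t) ?_
  have h := ((partialFourierInvSchwartz A).integrable_timeIntegral t).comp_neg
  refine h.congr (.of_forall fun x => ?_)
  have := A.fourierInv_timeIntegral t (-x)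
  simp only [Real.fourierInv_eq_fourier_neg, neg_neg] at this
  simp only [partialFourierInvSchwartz_apply, Real.fourierInv_eq_fourier_neg, neg_neg, this]

lemma SchwartzMap.fourier_fourierInv_slice (A : 𝓢(ℝ × E, ℂ)) (s : ℝ) :
    𝓕 (𝓕⁻ fun ξ => A (s, ξ)) = fun ξ => A (s, ξ) := by
  refine (A.continuous.comp (by fun_prop)).fourier_fourierInv_eq (A.integrable_slice s) ?_
  exact (partialFourierSchwartz A).integrable_slice s

lemma iteratedDeriv_cexp_neg_I (k : ℕ) :
    iteratedDeriv k (fun θ : ℝ => cexp (-I * θ)) = fun θ : ℝ => (-I) ^ k * cexp (-I * θ) := by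
  induction k with
  | zero => simp
  | succ k ih =>
    rw [iteratedDeriv_succ, ih]
    ext θ
    have h : HasDerivAt (fun θ : ℝ => -I * (θ : ℂ)) (-I) θ := by
      simpa using (Complex.ofRealCLM.hasDerivAt (x := θ)).const_mul (-I)
    rw [(h.cexp.const_mul ((-I) ^ k)).deriv]
    ring

lemma hasTemperateGrowth_cexp_neg_I : (fun θ : ℝ => cexp (-I * θ)).HasTemperateGrowth := by
  refine ⟨(contDiff_const.mul Complex.ofRealCLM.contDiff).cexp, fun k => ⟨0, 1, fun θ => ?_⟩⟩
  rw [norm_iteratedFDeriv_eq_norm_iteratedDeriv, iteratedDeriv_cexp_neg_I, norm_mul, norm_pow,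
    norm_neg, norm_I, Complex.norm_exp]
  simp

end TimeIntegral

section Multipliers
open scoped SchwartzMap

lemma DNLS.IsBump.hasTemperateGrowth {χ : ℝ → ℝ} (hχ : IsBump χ) : χ.HasTemperateGrowth := by
  refine HasCompactSupport.hasTemperateGrowth ?_ (contDiff_infty.2 hχ.smooth)
  refine HasCompactSupport.intro (isCompact_Icc (a := -2) (b := 2)) fun x hx => hχ.supp x ?_
  rw [Set.mem_Icc, ← abs_le] at hx
  exact (not_le.1 hx).le

lemma DNLS.IsBump.hasTemperateGrowth_norm {χ : ℝ → ℝ} (hχ : IsBump χ) {E : Type*}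
    [NormedAddCommGroup E] [InnerProductSpace ℝ E] [FiniteDimensional ℝ E] {c : ℝ} (hc : 0 < c) :
    (fun ξ : E => χ (c * ‖ξ‖)).HasTemperateGrowth := by
  refine HasCompactSupport.hasTemperateGrowth ?_ (contDiff_iff_contDiffAt.2 fun ξ => ?_)
  · refine HasCompactSupport.intro (isCompact_closedBall (0 : E) (2 / c)) fun ξ hξ => hχ.supp _ ?_
    rw [mem_closedBall_zero_iff, not_le, div_lt_iff₀' hc] at hξ
    rw [abs_of_nonneg (by positivity)]
    exact hξ.le
  · rcases eq_or_ne ξ 0 with rfl | h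
    · refine (contDiffAt_const (c := (1 : ℝ))).congr_of_eventuallyEq ?_
      have : ∀ᶠ ξ : E in 𝓝 0, c * ‖ξ‖ < 1 :=
        (continuous_const.mul continuous_norm).continuousAt.eventually_lt continuousAt_const
          (by simp)
      filter_upwards [this] with ξ hξ
      refine hχ.one _ ?_
      rw [abs_of_nonneg (by positivity)]
      exact hξ.le
    · exact (contDiff_infty.2 hχ.smooth).contDiffAt.comp ξ
        (contDiffAt_const.mul (contDiffAt_norm ℝ h))

lemma DNLS.IsBump.hasTemperateGrowth_psiR {χ : ℝ → ℝ} (hχ : IsBump χ) {n : ℕ} (j : ℤ) :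
    (fun ξ : Eucl n => (psiR χ ((2 : ℝ) ^ (-j) * ‖ξ‖) : ℂ)).HasTemperateGrowth := by
  have h2 : (0 : ℝ) < 2 ^ (-j) := zpow_pos two_pos _
  refine Function.HasTemperateGrowth.comp Complex.ofRealCLM.hasTemperateGrowth
    (f := fun ξ : Eucl n => psiR χ ((2 : ℝ) ^ (-j) * ‖ξ‖)) ?_
  simp only [hχ.psiR_eq, ← mul_assoc]
  exact (hχ.hasTemperateGrowth_norm h2).sub (hχ.hasTemperateGrowth_norm (mul_pos two_pos h2))

lemma DNLS.IsBump.hasTemperateGrowth_psiGe {χ : ℝ → ℝ} (hχ : IsBump χ) {n : ℕ} (k : ℤ)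
    (e : Eucl n) :
    (fun ξ : Eucl n => (psiGe χ k (inner ℝ ξ e : ℝ) : ℂ)).HasTemperateGrowth := by
  refine Function.HasTemperateGrowth.comp Complex.ofRealCLM.hasTemperateGrowth
    (f := fun ξ : Eucl n => psiGe χ k (inner ℝ ξ e : ℝ)) ?_
  simp only [hχ.psiGe_eq]
  refine (Function.HasTemperateGrowth.const 1).sub
    (hχ.hasTemperateGrowth.comp (f := fun ξ : Eucl n => 2 * ((2 : ℝ) ^ (-k) * inner ℝ ξ e)) ?_)
  fun_prop

variable {n : ℕ}

lemma hasTemperateGrowth_quadSym (ε : Fin n → ℝ) : (quadSym ε).HasTemperateGrowth := by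
  refine Function.HasTemperateGrowth.sum (s := Finset.univ)
    (f := fun i (ξ : Eucl n) => ε i * (ξ i) ^ 2) fun i _ => ?_
  exact (Function.HasTemperateGrowth.const (ε i)).mul
    ((EuclideanSpace.proj i : Eucl n →L[ℝ] ℝ).hasTemperateGrowth.pow 2)

lemma hasTemperateGrowth_propagator (ε : Fin n → ℝ) (t : ℝ) :
    (fun p : ℝ × Eucl n => cexp (-I * (t - p.1 : ℝ) * quadSym ε p.2)).HasTemperateGrowth := by
  have h : (fun p : ℝ × Eucl n => (t - p.1) * quadSym ε p.2).HasTemperateGrowth :=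
    ((Function.HasTemperateGrowth.const t).sub
      (ContinuousLinearMap.fst ℝ ℝ (Eucl n)).hasTemperateGrowth).mul
      ((hasTemperateGrowth_quadSym ε).comp (ContinuousLinearMap.snd ℝ ℝ (Eucl n)).hasTemperateGrowth)
  have h' := hasTemperateGrowth_cexp_neg_I.comp h
  have heq : (fun p : ℝ × Eucl n => cexp (-I * (t - p.1 : ℝ) * quadSym ε p.2))
      = (fun θ : ℝ => cexp (-I * θ)) ∘ fun p : ℝ × Eucl n => (t - p.1) * quadSym ε p.2 := by
    ext p
    simp only [Function.comp_apply]
    push_cast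
    ring_nf
  rwa [heq]

/-- The Fourier-side Duhamel integrand as a Schwartz function. -/
def duhamelIntegrand (ε : Fin n → ℝ) (t : ℝ) (g : 𝓢(ℝ × Eucl n, ℂ)) : 𝓢(ℝ × Eucl n, ℂ) :=
  SchwartzMap.smulLeftCLM ℂ (fun p : ℝ × Eucl n => cexp (-I * (t - p.1 : ℝ) * quadSym ε p.2)) g

lemma duhamelIntegrand_apply (ε : Fin n → ℝ) (t : ℝ) (g : 𝓢(ℝ × Eucl n, ℂ)) (s : ℝ) (ξ : Eucl n) :
    duhamelIntegrand ε t g (s, ξ) = cexp (-I * (t - s : ℝ) * quadSym ε ξ) * g (s, ξ) := by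
  rw [duhamelIntegrand, SchwartzMap.smulLeftCLM_apply_apply (hasTemperateGrowth_propagator ε t),
    smul_eq_mul]

/-- Multiplication by a symbol in the second variable. -/
def symbolMul (m : Eucl n → ℂ) (g : 𝓢(ℝ × Eucl n, ℂ)) : 𝓢(ℝ × Eucl n, ℂ) :=
  SchwartzMap.smulLeftCLM ℂ (fun p : ℝ × Eucl n => m p.2) g

lemma symbolMul_apply {m : Eucl n → ℂ} (hm : m.HasTemperateGrowth) (g : 𝓢(ℝ × Eucl n, ℂ))
    (s : ℝ) (ξ : Eucl n) : symbolMul m g (s, ξ) = m ξ * g (s, ξ) := by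
  have h : (fun p : ℝ × Eucl n => m p.2).HasTemperateGrowth :=
    hm.comp (ContinuousLinearMap.snd ℝ ℝ (Eucl n)).hasTemperateGrowth
  rw [symbolMul, SchwartzMap.smulLeftCLM_apply_apply h, smul_eq_mul]

lemma duhamel_eq_fourierInv (ε : Fin n → ℝ) (F : 𝓢(ℝ × Eucl n, ℂ)) (t : ℝ) :
    (fun x => duhamel ε (fun q => F q) (t, x))
      = 𝓕⁻ fun ξ => ∫ s in (0 : ℝ)..t, duhamelIntegrand ε t (partialFourierSchwartz F) (s, ξ) := by
  ext x
  rw [SchwartzMap.fourierInv_timeIntegral]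
  simp only [duhamelIntegrand_apply, partialFourierSchwartz_apply]
  rfl

/-- The localised Duhamel integral on the Fourier side. -/
lemma DNLS.IsBump.projT_qprojT_duhamel {χ : ℝ → ℝ} (hχ : IsBump χ) (ε : Fin n → ℝ)
    (F : 𝓢(ℝ × Eucl n, ℂ)) (j l : ℤ) (e : Eucl n) (t : ℝ) (x : Eucl n) :
    projT χ j (qprojT χ e j l (duhamel ε (fun q => F q))) (t, x)
      = 𝓕⁻ (fun ξ => (psiGe χ (j - l) (inner ℝ ξ e : ℝ) : ℂ) *
          ∫ s in (0 : ℝ)..t, cexp (-I * (t - s : ℝ) * quadSym ε ξ) *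
            symbolMul (fun ξ => (psiR χ ((2 : ℝ) ^ (-j) * ‖ξ‖) : ℂ)) (partialFourierSchwartz F)
              (s, ξ)) x := by
  have h1 : (fun y => qprojT χ e j l (duhamel ε (fun q => F q)) (t, y)) = 𝓕⁻ fun ξ =>
      ∫ s in (0 : ℝ)..t, symbolMul (fun ξ : Eucl n => (psiGe χ (j - l) (inner ℝ ξ e : ℝ) : ℂ))
        (duhamelIntegrand ε t (partialFourierSchwartz F)) (s, ξ) := by
    simp only [symbolMul_apply (hχ.hasTemperateGrowth_psiGe (j - l) e),
      intervalIntegral.integral_const_mul]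
    have := (duhamelIntegrand ε t (partialFourierSchwartz F)).fourier_fourierInv_timeIntegral t
    rw [← duhamel_eq_fourierInv] at this
    simp only [← fun ξ => congrFun this ξ]
    rfl
  rw [projT, proj, h1, mulOp, SchwartzMap.fourier_fourierInv_timeIntegral]
  refine congrArg (fun f : Eucl n → ℂ => (𝓕⁻ f : Eucl n → ℂ) x) (funext fun ξ => ?_)
  simp only [symbolMul_apply (hχ.hasTemperateGrowth_psiGe (j - l) e),
    symbolMul_apply (hχ.hasTemperateGrowth_psiR j), duhamelIntegrand_apply]
  rw [← intervalIntegral.integral_const_mul, ← intervalIntegral.integral_const_mul]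
  congr 1
  ext s
  ring

end Multipliers

section Splitting
open scoped SchwartzMap

variable {E H : Type} [NormedAddCommGroup E] [InnerProductSpace ℝ E] [FiniteDimensional ℝ E]
  [MeasurableSpace E] [BorelSpace E] [NormedAddCommGroup H] [InnerProductSpace ℝ H]
  [FiniteDimensional ℝ H] [MeasurableSpace H] [BorelSpace H]

/-- Orthogonal Cartesian coordinates, the first of which is real valued. -/
structure IsOrthogonalSplitting (Ψ : (ℝ × H) ≃L[ℝ] E) : Prop where
  measurePreserving : MeasurePreserving Ψ (volume.prod volume) volume
  inner_map : ∀ p p', (inner ℝ (Ψ p) (Ψ p') : ℝ) = p.1 * p'.1 + inner ℝ p.2 p'.2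

variable {Ψ : (ℝ × H) ≃L[ℝ] E}

lemma IsOrthogonalSplitting.integral_comp (hΨ : IsOrthogonalSplitting Ψ) (f : E → ℂ) :
    ∫ p, f (Ψ p) ∂(volume.prod volume) = ∫ x, f x :=
  hΨ.measurePreserving.integral_comp Ψ.toHomeomorph.measurableEmbedding f

lemma IsOrthogonalSplitting.integrable_comp (hΨ : IsOrthogonalSplitting Ψ) {f : E → ℂ}
    (hf : Integrable f) : Integrable (fun p => f (Ψ p)) (volume.prod volume) :=
  (hΨ.measurePreserving.integrable_comp_emb Ψ.toHomeomorph.measurableEmbedding).2 hf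

lemma IsOrthogonalSplitting.fourierInv_apply (hΨ : IsOrthogonalSplitting Ψ) {f : E → ℂ}
    (hf : Integrable f) (r : ℝ) (v : H) :
    𝓕⁻ f (Ψ (r, v)) = 𝓕⁻ (fun η => ∫ ρ : ℝ, cexp (2 * Real.pi * I * r * ρ) * f (Ψ (ρ, η))) v := by
  rw [Real.fourierInv_eq', Real.fourierInv_eq', ← hΨ.integral_comp, integral_prod_symm]
  · refine integral_congr_ae (.of_forall fun η => ?_)
    dsimp only
    rw [smul_eq_mul, ← integral_const_mul]
    refine integral_congr_ae (.of_forall fun ρ => ?_)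
    dsimp only
    rw [hΨ.inner_map, smul_eq_mul, ← mul_assoc, ← Complex.exp_add]
    congr 2
    push_cast
    ring
  · refine (hΨ.integrable_comp hf).mono ?_ (.of_forall fun p => le_of_eq ?_)
    · have hc : Continuous fun p : ℝ × H =>
          cexp (((2 * Real.pi * ⟪Ψ p, Ψ (r, v)⟫ : ℝ) : ℂ) * I) := by fun_prop
      exact hc.aestronglyMeasurable.smul (hΨ.integrable_comp hf).aestronglyMeasurable
    · rw [norm_smul, Complex.norm_exp_ofReal_mul_I, one_mul]

lemma IsOrthogonalSplitting.fourier_apply (hΨ : IsOrthogonalSplitting Ψ) {f : E → ℂ}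
    (hf : Integrable f) (ρ : ℝ) (η : H) :
    𝓕 f (Ψ (ρ, η)) = ∫ r : ℝ, cexp (-(2 * Real.pi * I * r * ρ)) * 𝓕 (fun v => f (Ψ (r, v))) η := by
  rw [Real.fourier_eq', ← hΨ.integral_comp, integral_prod]
  · refine integral_congr_ae (.of_forall fun r => ?_)
    dsimp only
    rw [Real.fourier_eq', ← integral_const_mul]
    refine integral_congr_ae (.of_forall fun v => ?_)
    dsimp only
    rw [hΨ.inner_map, smul_eq_mul, smul_eq_mul, ← mul_assoc, ← Complex.exp_add]
    congr 2
    push_cast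
    ring
  · refine (hΨ.integrable_comp hf).mono ?_ (.of_forall fun p => le_of_eq ?_)
    · have hc : Continuous fun p : ℝ × H =>
          cexp (((-2 * Real.pi * ⟪Ψ p, Ψ (ρ, η)⟫ : ℝ) : ℂ) * I) := by fun_prop
      exact hc.aestronglyMeasurable.smul (hΨ.integrable_comp hf).aestronglyMeasurable
    · rw [norm_smul, Complex.norm_exp_ofReal_mul_I, one_mul]

/-- A space-time Schwartz function in split coordinates. -/
def splitSchwartz (Ψ : (ℝ × H) ≃L[ℝ] E) (G : 𝓢(ℝ × E, ℂ)) : 𝓢((ℝ × ℝ) × H, ℂ) :=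
  SchwartzMap.compCLMOfContinuousLinearEquiv ℝ
    ((ContinuousLinearEquiv.prodAssoc ℝ ℝ ℝ H).trans
      ((ContinuousLinearEquiv.refl ℝ ℝ).prodCongr Ψ)) G

omit [FiniteDimensional ℝ E] [MeasurableSpace E] [BorelSpace E] [FiniteDimensional ℝ H]
  [MeasurableSpace H] [BorelSpace H] in
lemma splitSchwartz_apply (G : 𝓢(ℝ × E, ℂ)) (s r : ℝ) (v : H) :
    splitSchwartz Ψ G ((s, r), v) = G (s, Ψ (r, v)) := rfl

lemma IsOrthogonalSplitting.fourierInv_duhamel (hΨ : IsOrthogonalSplitting Ψ)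
    {m : ℝ → H → ℂ} {q : ℝ → H → ℝ} {R B : ℝ} (hm : IsAmplitude m R B)
    (hq : Continuous fun p : ℝ × H => q p.1 p.2) (G : 𝓢(ℝ × E, ℂ)) {qE : E → ℝ} {mE : E → ℂ}
    (hqE : ∀ ρ η, qE (Ψ (ρ, η)) = q ρ η)
    (hmE : ∀ s ρ η, mE (Ψ (ρ, η)) * partialFourierSchwartz G (s, Ψ (ρ, η))
      = m ρ η * partialFourierSchwartz G (s, Ψ (ρ, η))) (t : ℝ)
    (hi : Integrable fun ξ => mE ξ * ∫ s in (0 : ℝ)..t,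
      cexp (-I * (t - s : ℝ) * qE ξ) * partialFourierSchwartz G (s, ξ)) (r : ℝ) (v : H) :
    𝓕⁻ (fun ξ => mE ξ * ∫ s in (0 : ℝ)..t,
        cexp (-I * (t - s : ℝ) * qE ξ) * partialFourierSchwartz G (s, ξ)) (Ψ (r, v))
      = 𝓕⁻ (fun η => ∫ r', axisDuhamel m q (partialFourierSchwartz (splitSchwartz Ψ G)) r t r' η)
        v := by
  rw [hΨ.fourierInv_apply hi]
  refine congrArg (fun f : H → ℂ => (𝓕⁻ f : H → ℂ) v) (funext fun η => ?_)
  rw [← hm.integral_axisDuhamel hq]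
  refine integral_congr_ae (.of_forall fun ρ => ?_)
  dsimp only
  congr 1
  rw [← intervalIntegral.integral_const_mul]
  refine intervalIntegral.integral_congr fun s _ => ?_
  rw [mul_left_comm, hmE, hqE, mul_left_comm, partialFourierSchwartz_apply,
    hΨ.fourier_apply (G.integrable_slice s)]
  rfl

end Splitting

section Hyperplane
open scoped SchwartzMap

variable {n : ℕ}

lemma inner_hyperplane {e : Eucl n} (η : hyperplane e) : (inner ℝ e (η : Eucl n) : ℝ) = 0 :=
  Submodule.mem_orthogonal_singleton_iff_inner_right.1 η.2

/-- The coordinates `(ρ, η) ↦ ρ • e + η` attached to a unit vector. -/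
def axisCoords (e : Eucl n) (he : ‖e‖ = 1) : (ℝ × hyperplane e) ≃L[ℝ] Eucl n :=
  (((LinearIsometryEquiv.toSpanUnitSingleton (𝕜 := ℝ) e he).toContinuousLinearEquiv.prodCongr
    (ContinuousLinearEquiv.refl ℝ (hyperplane e))).trans
    (WithLp.prodContinuousLinearEquiv 2 ℝ (ℝ ∙ e) (hyperplane e)).symm).trans
    ((ℝ ∙ e).orthogonalDecomposition.symm).toContinuousLinearEquiv

lemma axisCoords_apply (e : Eucl n) (he : ‖e‖ = 1) (ρ : ℝ) (η : hyperplane e) :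
    axisCoords e he (ρ, η) = ρ • e + (η : Eucl n) := by
  change (ℝ ∙ e).orthogonalDecomposition.symm
    (WithLp.toLp 2 (LinearIsometryEquiv.toSpanUnitSingleton (𝕜 := ℝ) e he ρ, η)) = _
  rw [Submodule.orthogonalDecomposition_symm_apply]
  simp

lemma isOrthogonalSplitting_axisCoords (e : Eucl n) (he : ‖e‖ = 1) :
    IsOrthogonalSplitting (axisCoords e he) where
  measurePreserving :=
    (ℝ ∙ e).orthogonalDecomposition.symm.measurePreserving.comp
      ((WithLp.volume_preserving_toLp (ℝ ∙ e) (hyperplane e)).comp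
        ((LinearIsometryEquiv.toSpanUnitSingleton (𝕜 := ℝ) e he).measurePreserving.prod
          (MeasurePreserving.id volume)))
  inner_map := by
    rintro ⟨ρ, η⟩ ⟨ρ', η'⟩
    have h : (inner ℝ (η : Eucl n) e : ℝ) = 0 := by
      rw [real_inner_comm, inner_hyperplane]
    simp only [axisCoords_apply, inner_add_left, inner_add_right, real_inner_smul_left,
      real_inner_smul_right, inner_hyperplane, h, real_inner_self_eq_norm_sq, he,
      Submodule.coe_inner]
    ring

end Hyperplane

section Localized
open scoped SchwartzMap

variable {n : ℕ} {χ : ℝ → ℝ} {ε : Fin n → ℝ}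

/-- The localised symbol in coordinates along `e`, at frequency scale `l`. -/
def axisSymbol (χ : ℝ → ℝ) (ε : Fin n → ℝ) (e : Eucl n) (l ρ : ℝ) (η : hyperplane e) : ℂ :=
  (χ (l⁻¹ * ρ / 2) *
    (1 - χ (2 ^ 21 * l⁻¹ * (quadSym ε e * ρ + inner ℝ (η : Eucl n) (epm ε e)))) : ℝ)

lemma DNLS.IsBump.isAmplitude_axisSymbol (hχ : IsBump χ) (ε : Fin n → ℝ) (e : Eucl n) {l : ℝ}
    (hl : 0 < l) : ∃ B, IsAmplitude (axisSymbol χ ε e l) (4 * l) B := by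
  obtain ⟨B, hB, h0, h1, -, -⟩ := hχ.exists_bounds
  have hc : Continuous χ := (hχ.smooth 0).continuous
  refine ⟨B * B, ?_, fun ρ η => ?_, fun ρ η h => ?_⟩
  · unfold axisSymbol
    fun_prop
  · rw [axisSymbol, Complex.norm_real, norm_mul]
    exact mul_le_mul (h0 _) (h1 _) (norm_nonneg _) (by linarith)
  · rw [axisSymbol, hχ.supp, zero_mul, Complex.ofReal_zero]
    rw [abs_div, abs_mul, abs_inv, abs_of_pos hl, abs_two, le_div_iff₀ two_pos,
      inv_mul_eq_div, le_div_iff₀ hl]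
    linarith

lemma DNLS.IsBump.exists_axisSymbol_resolvent_bound (hχ : IsBump χ)
    (hε : ∀ i, ε i = 1 ∨ ε i = -1) : ∃ C, 0 ≤ C ∧ ∀ (e : Eucl n) (l : ℝ), ‖e‖ = 1 → 0 < l →
      ∀ (η : hyperplane e) (y σ δ τ : ℝ), (σ = 1 ∨ σ = -1) → 0 < δ →
        ‖∫ ρ : ℝ, axisSymbol χ ε e l ρ η * cexp (2 * Real.pi * I * y * ρ)
          / (δ + I * (σ * quadSym ε (ρ • e + η) + 2 * Real.pi * τ : ℝ))‖ ≤ C * l⁻¹ := by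
  obtain ⟨C, hC, h⟩ := hχ.exists_resolvent_bound_scaled (N := 2 ^ 21) (by norm_num)
  refine ⟨C, hC, fun e l he hl η y σ δ τ hσ hδ => ?_⟩
  have ha : |σ * quadSym ε e| ≤ 1 := by
    have h1 : |σ| = 1 := by rcases hσ with rfl | rfl <;> simp
    rw [abs_mul, h1, one_mul]
    simpa [he] using abs_quadSym_le hε e
  refine (le_of_eq ?_).trans (h (σ * quadSym ε e) (σ * inner ℝ (η : Eucl n) (epm ε e))
    (σ * quadSym ε (η : Eucl n) + 2 * Real.pi * τ) y δ l ha hδ.ne' hl)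
  refine congrArg _ (integral_congr_ae (.of_forall fun ρ => ?_))
  dsimp only
  congr 1
  · congr 1
    rw [axisSymbol]
    congr 3
    rcases hσ with rfl | rfl
    · simp
    · rw [← hχ.even (2 ^ 21 * l⁻¹ * _)]
      congr 2
      ring
  · rw [quadSym_smul_add]
    congr 3
    ring

lemma DNLS.IsBump.psiR_mul_axisSymbol (hχ : IsBump χ) (ε : Fin n → ℝ) {e : Eucl n} (he : ‖e‖ = 1)
    (j : ℤ) (ρ : ℝ) (η : hyperplane e) :
    ((psiGe χ (j - 20) (inner ℝ (ρ • e + η : Eucl n) (epm ε e)) : ℝ) : ℂ) *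
        ((psiR χ ((2 : ℝ) ^ (-j) * ‖ρ • e + (η : Eucl n)‖) : ℝ) : ℂ)
      = axisSymbol χ ε e ((2 : ℝ) ^ j) ρ η *
        ((psiR χ ((2 : ℝ) ^ (-j) * ‖ρ • e + (η : Eucl n)‖) : ℝ) : ℂ) := by
  have hρ : |ρ| ≤ ‖ρ • e + (η : Eucl n)‖ := by
    have h := abs_real_inner_le_norm e (ρ • e + (η : Eucl n))
    rwa [inner_add_right, inner_hyperplane, real_inner_smul_right, real_inner_self_eq_norm_sq, he,
      one_pow, mul_one, add_zero, one_mul] at h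
  set s := ‖ρ • e + (η : Eucl n)‖
  have hl : (0 : ℝ) < 2 ^ j := by positivity
  rcases le_or_gt 2 ((2 : ℝ) ^ (-j) * s) with h2 | h2
  · have : psiR χ ((2 : ℝ) ^ (-j) * s) = 0 := by
      have h4 : 2 ≤ |(2 : ℝ) ^ (-j) * s| := h2.trans (le_abs_self _)
      rw [hχ.psiR_eq, hχ.supp _ h4, hχ.supp, sub_zero]
      rw [abs_mul, abs_two]
      linarith
    rw [this, Complex.ofReal_zero, mul_zero, mul_zero]
  · congr 2
    rw [hχ.psiGe_eq, hχ.one (((2 : ℝ) ^ j)⁻¹ * ρ / 2), one_mul, inner_epm_smul_add]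
    · congr 2
      rw [neg_sub, zpow_sub₀ two_ne_zero]
      norm_num
      ring
    · rw [zpow_neg, inv_mul_lt_iff₀ hl] at h2
      rw [abs_div, abs_mul, abs_inv, abs_of_pos hl, abs_two, div_le_iff₀ two_pos,
        inv_mul_le_iff₀ hl]
      linarith

end Localized

section Estimate
open scoped SchwartzMap

variable {n : ℕ} {χ : ℝ → ℝ} {ε : Fin n → ℝ}

lemma innerQ_two_sq_le (e : Eucl n) (u : ℝ × Eucl n → ℂ) (r : ℝ) :
    innerQ 2 e u r ^ 2 ≤ ∫⁻ t : ℝ, ∫⁻ v : hyperplane e, ‖u (t, r • e + (v : Eucl n))‖ₑ ^ 2 := by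
  rw [innerQ, eLpNorm_two_sq, Measure.volume_eq_prod]
  exact lintegral_prod_le _

lemma innerQ_two_eq {e : Eucl n} (he : ‖e‖ = 1) (G : 𝓢(ℝ × Eucl n, ℂ)) (r : ℝ) :
    innerQ 2 e (fun p => G p) r = (∫⁻ s : ℝ, ∫⁻ v : hyperplane e,
      ‖splitSchwartz (axisCoords e he) G ((s, r), v)‖ₑ ^ 2) ^ (1 / 2 : ℝ) := by
  have h : innerQ 2 e (fun p => G p) r ^ 2 = ∫⁻ s : ℝ, ∫⁻ v : hyperplane e,
      ‖splitSchwartz (axisCoords e he) G ((s, r), v)‖ₑ ^ 2 := by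
    simp only [splitSchwartz_apply, axisCoords_apply]
    rw [innerQ, eLpNorm_two_sq, Measure.volume_eq_prod, lintegral_prod]
    exact (G.continuous.comp (by fun_prop)).measurable.enorm.pow_const 2 |>.aemeasurable
  rw [← h, ← ENNReal.rpow_natCast, ← ENNReal.rpow_mul]
  norm_num

/-- The localised forcing term as a Schwartz function. -/
def localizedForcing (χ : ℝ → ℝ) (j : ℤ) (F : 𝓢(ℝ × Eucl n, ℂ)) : 𝓢(ℝ × Eucl n, ℂ) :=
  partialFourierInvSchwartz (symbolMul
    (fun ξ => (psiR χ ((2 : ℝ) ^ (-j) * ‖ξ‖) : ℂ)) (partialFourierSchwartz F))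

lemma partialFourierSchwartz_localizedForcing (χ : ℝ → ℝ) (j : ℤ) (F : 𝓢(ℝ × Eucl n, ℂ)) :
    partialFourierSchwartz (localizedForcing χ j F) = symbolMul
      (fun ξ => (psiR χ ((2 : ℝ) ^ (-j) * ‖ξ‖) : ℂ)) (partialFourierSchwartz F) := by
  ext ⟨s, ξ⟩
  rw [partialFourierSchwartz_apply]
  simp only [localizedForcing, partialFourierInvSchwartz_apply]
  exact congrFun (SchwartzMap.fourier_fourierInv_slice _ s) ξ

lemma DNLS.IsBump.projT_eq_localizedForcing (hχ : IsBump χ) (j : ℤ) (F : 𝓢(ℝ × Eucl n, ℂ)) :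
    projT χ j (fun q => F q) = fun q => localizedForcing χ j F q := by
  ext ⟨s, x⟩
  simp only [localizedForcing, partialFourierInvSchwartz_apply,
    symbolMul_apply (hχ.hasTemperateGrowth_psiR j)]
  rfl

/-- The localised smoothing estimate at a fixed position along the direction `e`. -/
lemma DNLS.IsBump.exists_innerQ_duhamel_le (hχ : IsBump χ) (hε : ∀ i, ε i = 1 ∨ ε i = -1) :
    ∃ C : ℝ, 0 ≤ C ∧ ∀ (F : 𝓢(ℝ × Eucl n, ℂ)) (j : ℤ) (e : Eucl n), ‖e‖ = 1 → ∀ r : ℝ,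
      innerQ 2 e (projT χ j (qprojT χ (epm ε e) j 20 (duhamel ε (fun q => F q)))) r
        ≤ ENNReal.ofReal (C * ((2 : ℝ) ^ j)⁻¹) *
          ∫⁻ r', innerQ 2 e (projT χ j (fun q => F q)) r' := by
  obtain ⟨C, hC, h⟩ := hχ.exists_axisSymbol_resolvent_bound hε
  refine ⟨C, hC, fun F j e he r => ?_⟩
  have hl : (0 : ℝ) < 2 ^ j := by positivity
  obtain ⟨B, hm⟩ := hχ.isAmplitude_axisSymbol ε e hl
  have hq : Continuous fun p : ℝ × hyperplane e => quadSym ε (p.1 • e + (p.2 : Eucl n)) :=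
    (hasTemperateGrowth_quadSym ε).1.continuous.comp (by fun_prop)
  rw [hχ.projT_eq_localizedForcing]
  set G := localizedForcing χ j F with hG
  have hpG := partialFourierSchwartz_localizedForcing χ j F
  rw [← hG] at hpG
  simp only [innerQ_two_eq he]
  rw [← ENNReal.pow_le_pow_left_iff two_ne_zero]
  refine (innerQ_two_sq_le e _ r).trans ((le_of_eq ?_).trans
    (hm.lintegral_fourierInv_axisDuhamel_le hq (splitSchwartz (axisCoords e he) G)
      (fun η y σ δ τ => h e _ he hl η y σ δ τ) r))
  refine lintegral_congr fun t => lintegral_congr fun v => ?_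
  rw [← (isOrthogonalSplitting_axisCoords e he).fourierInv_duhamel hm hq G
    (qE := quadSym ε) (mE := fun ξ => (psiGe χ (j - 20) (inner ℝ ξ (epm ε e)) : ℂ)) ?_ ?_ t ?_ r v,
    hχ.projT_qprojT_duhamel, hpG, axisCoords_apply]
  · simp only [axisCoords_apply, implies_true]
  · intro s ρ η
    rw [hpG, axisCoords_apply, symbolMul_apply (hχ.hasTemperateGrowth_psiR j), ← mul_assoc,
      ← mul_assoc, hχ.psiR_mul_axisSymbol ε he]
  · have hi := (symbolMul (fun ξ : Eucl n => (psiGe χ (j - 20) (inner ℝ ξ (epm ε e)) : ℂ))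
      (duhamelIntegrand ε t (partialFourierSchwartz G))).integrable_timeIntegral t
    simpa only [symbolMul_apply (hχ.hasTemperateGrowth_psiGe (j - 20) (epm ε e)),
      duhamelIntegrand_apply, intervalIntegral.integral_const_mul] using hi

end Estimate

/-- `2^{j/2}‖P_j Q^{e_±}_{j,20} ∫_0^t W_±(t-s)F(s)ds‖_{L^{∞,2}_e}
≤ C 2^{-j/2} sup_{e'}‖P_j F‖_{L^{1,2}_{e'}}`. -/
theorem duhamel_smoothing_localized
    (n : ℕ) (hn : 2 ≤ n) (ε : Fin n → ℝ) (hε : ∀ i, ε i = 1 ∨ ε i = -1)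
    (χ : ℝ → ℝ) (hχ : IsBump χ) :
    ∃ C : ℝ, 0 < C ∧ ∀ (F : SchwartzMap (ℝ × Eucl n) ℂ) (j : ℤ) (e : Eucl n), ‖e‖ = 1 →
      tp ((j : ℝ) / 2) *
        aniNorm ∞ 2 e
          (projT χ j (qprojT χ (epm ε e) j 20 (duhamel ε (fun q => F q))))
      ≤ ENNReal.ofReal C * tp (-(j : ℝ) / 2) *
          sphSup (fun e' => aniNorm 1 2 e' (projT χ j (fun q => F q))) := by
  obtain ⟨C, hC, h⟩ := hχ.exists_innerQ_duhamel_le hε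
  refine ⟨C + 1, by positivity, fun F j e he => ?_⟩
  have hsup : ∫⁻ r', innerQ 2 e (projT χ j (fun q => F q)) r'
      ≤ sphSup (fun e' => aniNorm 1 2 e' (projT χ j (fun q => F q))) := by
    refine le_trans (le_of_eq ?_) (le_iSup₂ (f := fun (e' : Eucl n) (_ : ‖e'‖ = 1) =>
      aniNorm 1 2 e' (projT χ j (fun q => F q))) e he)
    simp [aniNorm]
  have hess : aniNorm ∞ 2 e (projT χ j (qprojT χ (epm ε e) j 20 (duhamel ε (fun q => F q))))
      ≤ ENNReal.ofReal (C * ((2 : ℝ) ^ j)⁻¹) *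
        ∫⁻ r', innerQ 2 e (projT χ j (fun q => F q)) r' := by
    rw [aniNorm, if_pos rfl]
    exact essSup_le_of_ae_le _ (.of_forall (h F j e he))
  have hpow : (2 : ℝ) ^ ((j : ℝ) / 2) * ((2 : ℝ) ^ j)⁻¹ = (2 : ℝ) ^ (-(j : ℝ) / 2) := by
    rw [← Real.rpow_intCast, ← Real.rpow_neg two_pos.le, ← Real.rpow_add two_pos]
    congr 1
    ring
  calc _ ≤ tp ((j : ℝ) / 2) * (ENNReal.ofReal (C * ((2 : ℝ) ^ j)⁻¹) *
        sphSup (fun e' => aniNorm 1 2 e' (projT χ j (fun q => F q)))) := by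
        gcongr
        exact hess.trans (by gcongr)
    _ ≤ _ := by
      rw [← mul_assoc, tp, tp, ← ENNReal.ofReal_mul (by positivity),
        ← ENNReal.ofReal_mul (by positivity)]
      rw [mul_left_comm, hpow]
      gcongr
      linarith
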